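/- arXiv:2603.23316 — 4 statements merged into one kernel-verified Lean document; each statement's English description precedes it below -/
import Mathlib

section
/- For any two geometric data sets X and Y, the infimum defining the observable distance over couplings is attained: d_conc(X,Y) = min{ H_{d_KF^π}(F_X ∘ pr₁, F_Y ∘ pr₂) : π ∈ Π(μ_X, μ_Y) }, where H_{d_KF^π} is the Hausdorff distance with respect to the Ky Fan metric d_KF^π on maps defined on X × Y. -/
open MeasureTheory Topology Filter ENNReal

noncomputable section

/-- The Ky Fan (extended) pseudometric between two maps, w.r.t. a measure `π`:
`inf {ε ≥ 0 | π {ω | d (u ω) (v ω) > ε} ≤ ε}`. -/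
def kyFan {Ω E : Type*} [MeasurableSpace Ω] [PseudoEMetricSpace E]
    (π : Measure Ω) (u v : Ω → E) : ℝ≥0∞ :=
  sInf {ε : ℝ≥0∞ | π {ω | ε < edist (u ω) (v ω)} ≤ ε}

/-- Hausdorff distance between two sets w.r.t. an abstract extended pseudometric `d`. -/
def hausd {α : Type*} (d : α → α → ℝ≥0∞) (A B : Set α) : ℝ≥0∞ :=
  max (⨆ a : A, ⨅ b : B, d a b) (⨆ b : B, ⨅ a : A, d a b)

/-- The sup (extended) pseudometric `d∞^A` over a subset `A`. -/
def dInfty {α β : Type*} [PseudoEMetricSpace β] (A : Set α) (u v : α → β) : ℝ≥0∞ :=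
  ⨆ a : A, edist (u a) (v a)

/-- A geometric data set: a complete separable metric space whose distance is the
supremum of feature differences over a nonempty family `F` of real-valued functions,
equipped with a fully supported Borel probability measure. -/
structure GDS where
  carrier : Type
  met : MetricSpace carrier
  cms : CompleteSpace carrier
  sep : TopologicalSpace.SeparableSpace carrier
  msp : MeasurableSpace carrier
  bor : BorelSpace carrier
  F : Set (carrier → ℝ)
  F_nonempty : F.Nonempty
  dist_isLUB : ∀ x y : carrier, IsLUB ((fun f => |f x - f y|) '' F) (dist x y)
  μ : Measure carrier
  prob : IsProbabilityMeasure μ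
  full_support : ∀ U : Set carrier, IsOpen U → U.Nonempty → 0 < μ U

attribute [instance] GDS.met GDS.cms GDS.sep GDS.msp GDS.bor GDS.prob

/-- A coupling of the measures of two geometric data sets. -/
def GDS.Coupling (X Y : GDS) (π : Measure (X.carrier × Y.carrier)) : Prop :=
  IsProbabilityMeasure π ∧ π.map Prod.fst = X.μ ∧ π.map Prod.snd = Y.μ

/-- A parameter of a measure `μ`: a Borel measurable map from `[0,1]` (with Lebesgue
measure) pushing the Lebesgue measure forward to `μ`. -/
def IsParam {X : Type*} [MeasurableSpace X] (μ : Measure X)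
    (φ : Set.Icc (0:ℝ) 1 → X) : Prop :=
  Measurable φ ∧ Measure.map φ volume = μ

/-- The observable distance between two geometric data sets. -/
def dConc (X Y : GDS) : ℝ≥0∞ :=
  ⨅ (φ : Set.Icc (0:ℝ) 1 → X.carrier) (_ : IsParam X.μ φ)
    (ψ : Set.Icc (0:ℝ) 1 → Y.carrier) (_ : IsParam Y.μ ψ),
    hausd (kyFan (volume : Measure (Set.Icc (0:ℝ) 1)))
      ((· ∘ φ) '' X.F) ((· ∘ ψ) '' Y.F)

/-- `d_conc^π`, the Hausdorff distance w.r.t. the Ky Fan metric of a coupling `π`. -/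
def dConcCoupling (X Y : GDS) (π : Measure (X.carrier × Y.carrier)) : ℝ≥0∞ :=
  hausd (kyFan π) ((· ∘ Prod.fst) '' X.F) ((· ∘ Prod.snd) '' Y.F)

/-- The Prohorov distance between two Borel measures. -/
def prohorov {Z : Type*} [PseudoEMetricSpace Z] [MeasurableSpace Z]
    (μ ν : Measure Z) : ℝ≥0∞ :=
  sInf {ε : ℝ≥0∞ | ∀ A : Set Z, MeasurableSet A →
    ν A ≤ μ {z | EMetric.infEdist z A < ε} + ε}

/-- The `a`-partial diameter of a Borel measure on `ℝ`. -/
def partialDiam (ν : Measure ℝ) (a : ℝ≥0∞) : ℝ≥0∞ :=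
  ⨅ (I : Set ℝ) (_ : MeasurableSet I) (_ : a ≤ ν I), EMetric.diam I

/-- The `κ`-observable diameter `ObsDiam(X; -κ)` of a geometric data set. -/
def obsDiam (X : GDS) (κ : ℝ) : ℝ≥0∞ :=
  ⨆ f : X.F, partialDiam (X.μ.map f) (ENNReal.ofReal (1 - κ))

/-- The distortion of a subset `S ⊆ X × Y`. -/
def distortion {X Y : Type*} [PseudoMetricSpace X] [PseudoMetricSpace Y]
    (S : Set (X × Y)) : ℝ≥0∞ :=
  ⨆ (p : S) (q : S), edist (dist p.1.1 q.1.1) (dist p.1.2 q.1.2)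

/-- `□_π^S(F, G) = max {1 - π S, 2 H_{d∞^S}(F ∘ pr₁, G ∘ pr₂)}`. -/
def boxS (X Y : GDS) (π : Measure (X.carrier × Y.carrier))
    (S : Set (X.carrier × Y.carrier))
    (F : Set (X.carrier → ℝ)) (G : Set (Y.carrier → ℝ)) : ℝ≥0∞ :=
  max (1 - π S) (2 * hausd (dInfty S) ((· ∘ Prod.fst) '' F) ((· ∘ Prod.snd) '' G))

/-- `□_π(F, G)`, infimum of `□_π^S(F, G)` over closed `S`. -/
def boxCoupling (X Y : GDS) (π : Measure (X.carrier × Y.carrier))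
    (F : Set (X.carrier → ℝ)) (G : Set (Y.carrier → ℝ)) : ℝ≥0∞ :=
  ⨅ (S : Set (X.carrier × Y.carrier)) (_ : IsClosed S), boxS X Y π S F G

/-- The box distance between two geometric data sets. -/
def boxDist (X Y : GDS) : ℝ≥0∞ :=
  ⨅ (π : Measure (X.carrier × Y.carrier)) (_ : X.Coupling Y π),
    boxCoupling X Y π X.F Y.F

/-- The distortion `dis π` of a coupling `π`. -/
def disCoupling (X Y : GDS) (π : Measure (X.carrier × Y.carrier)) : ℝ≥0∞ :=
  ⨅ (S : Set (X.carrier × Y.carrier)) (_ : IsClosed S), max (1 - π S) (distortion S)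

/-- `X ⪯ Y` : the geometric data set `Y` dominates `X` (feature order). -/
def GDS.Dominates (Y X : GDS) : Prop :=
  ∃ p : Y.carrier → X.carrier, Measurable p ∧ Y.μ.map p = X.μ ∧
    (· ∘ p) '' X.F ⊆ closure Y.F

lemma GDS.lipschitzWith_of_mem_F (X : GDS) {f : X.carrier → ℝ} (hf : f ∈ X.F) :
    LipschitzWith 1 f :=
  LipschitzWith.of_dist_le_mul fun x y => by
    simpa [Real.dist_eq] using (X.dist_isLUB x y).1 ⟨f, hf, rfl⟩

lemma kyFan_map {Ω Ω' E : Type*} [MeasurableSpace Ω] [MeasurableSpace Ω']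
    [PseudoEMetricSpace E] [SecondCountableTopology E] [MeasurableSpace E]
    [OpensMeasurableSpace E] {μ : Measure Ω} {h : Ω → Ω'} (hh : Measurable h) {u v : Ω' → E}
    (hu : Measurable u) (hv : Measurable v) :
    kyFan (μ.map h) u v = kyFan μ (u ∘ h) (v ∘ h) := by
  unfold kyFan
  congr! 3 with ε
  rw [Measure.map_apply hh (measurableSet_lt measurable_const (hu.edist hv))]
  rfl

/-- For `1`-Lipschitz maps, the Ky Fan distance is `2`-Lipschitz in the measure with respect to the
Lévy–Prokhorov distance. -/
lemma kyFan_le_kyFan_add {Z E : Type*} [PseudoEMetricSpace E] [PseudoMetricSpace Z]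
    [MeasurableSpace Z] [OpensMeasurableSpace Z] (μ ν : Measure Z) {u v : Z → E}
    (hu : LipschitzWith 1 u) (hv : LipschitzWith 1 v) :
    kyFan μ u v ≤ kyFan ν u v + 2 * levyProkhorovEDist μ ν := by
  conv_rhs => rw [kyFan, levyProkhorovEDist, sInf_eq_iInf (s := {ε | ∀ B, _}), ENNReal.sInf_add]
  simp_rw [ENNReal.mul_iInf_of_ne two_ne_zero ofNat_ne_top, ENNReal.add_iInf]
  refine le_iInf₂ fun ε hε => le_iInf₂ fun c hc => ?_
  rcases eq_or_ne c ⊤ with rfl | hc_top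
  · simp
  have h_open : IsOpen {z | ε + 2 * c < edist (u z) (v z)} :=
    isOpen_lt continuous_const (hu.continuous.edist hv.continuous)
  have h_sub : Metric.thickening c.toReal {z | ε + 2 * c < edist (u z) (v z)} ⊆
      {z | ε < edist (u z) (v z)} := by
    intro z hz
    obtain ⟨w, hw, hzw⟩ := Metric.mem_thickening_iff.1 hz
    have hwz : edist z w ≤ c := by
      rw [edist_dist]
      exact ENNReal.ofReal_le_of_le_toReal hzw.le
    have hu' : edist (u w) (u z) ≤ c := by
      rw [edist_comm]
      exact (by simpa using hu z w : edist (u z) (u w) ≤ edist z w).trans hwz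
    have hv' : edist (v z) (v w) ≤ c :=
      (by simpa using hv z w : edist (v z) (v w) ≤ edist z w).trans hwz
    by_contra hle
    rw [Set.mem_ofPred_eq] at hle hw
    refine hw.not_ge ?_
    calc edist (u w) (v w)
        ≤ edist (u w) (u z) + edist (u z) (v z) + edist (v z) (v w) := edist_triangle4 ..
      _ ≤ c + ε + c := by gcongr; exact not_lt.1 hle
      _ = ε + 2 * c := by ring
  refine sInf_le ?_
  calc μ {z | ε + 2 * c < edist (u z) (v z)}
      ≤ ν (Metric.thickening c.toReal {z | ε + 2 * c < edist (u z) (v z)}) + c :=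
        (hc _ h_open.measurableSet).1
    _ ≤ ε + c := by gcongr; exact (measure_mono h_sub).trans hε
    _ ≤ ε + 2 * c := by gcongr; exact le_mul_of_one_le_left' one_le_two

lemma hausd_le_hausd_add {α : Type*} {d d' : α → α → ℝ≥0∞} {A B : Set α} {c : ℝ≥0∞}
    (h : ∀ a ∈ A, ∀ b ∈ B, d a b ≤ d' a b + c) : hausd d A B ≤ hausd d' A B + c := by
  refine max_le (iSup_le fun a => ?_) (iSup_le fun b => ?_)
  · calc ⨅ b : B, d a b ≤ ⨅ b : B, (d' a b + c) := iInf_mono fun b => h a a.2 b b.2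
      _ = (⨅ b : B, d' a b) + c := ENNReal.iInf_add.symm
      _ ≤ hausd d' A B + c := by
        gcongr
        exact le_max_of_le_left (le_iSup (fun a : A => ⨅ b : B, d' a b) a)
  · calc ⨅ a : A, d a b ≤ ⨅ a : A, (d' a b + c) := iInf_mono fun a => h a a.2 b b.2
      _ = (⨅ a : A, d' a b) + c := ENNReal.iInf_add.symm
      _ ≤ hausd d' A B + c := by
        gcongr
        exact le_max_of_le_right (le_iSup (fun b : B => ⨅ a : A, d' a b) b)

lemma hausd_image {α β γ : Type*} (d : γ → γ → ℝ≥0∞) (p : α → γ) (q : β → γ) (A : Set α)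
    (B : Set β) :
    hausd d (p '' A) (q '' B) =
      max (⨆ a : A, ⨅ b : B, d (p a) (q b)) (⨆ b : B, ⨅ a : A, d (p a) (q b)) := by
  simp only [hausd, iSup_subtype, iInf_subtype, iSup_image, iInf_image]

lemma dConcCoupling_map (X Y : GDS) {Ω : Type*} [MeasurableSpace Ω] (μ : Measure Ω)
    {h : Ω → X.carrier × Y.carrier} (hh : Measurable h) :
    dConcCoupling X Y (μ.map h) = hausd (kyFan μ)
      ((· ∘ (Prod.fst ∘ h)) '' X.F) ((· ∘ (Prod.snd ∘ h)) '' Y.F) := by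
  have key (f : X.F) (g : Y.F) : kyFan (μ.map h) (f.1 ∘ Prod.fst) (g.1 ∘ Prod.snd) =
      kyFan μ (f.1 ∘ (Prod.fst ∘ h)) (g.1 ∘ (Prod.snd ∘ h)) :=
    kyFan_map hh ((X.lipschitzWith_of_mem_F f.2).continuous.measurable.comp measurable_fst)
      ((Y.lipschitzWith_of_mem_F g.2).continuous.measurable.comp measurable_snd)
  simp only [dConcCoupling, hausd_image, key]

lemma dConcCoupling_le_add (X Y : GDS) (μ ν : Measure (X.carrier × Y.carrier)) :
    dConcCoupling X Y μ ≤ dConcCoupling X Y ν + 2 * levyProkhorovEDist μ ν := by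
  refine hausd_le_hausd_add ?_
  rintro _ ⟨f, hf, rfl⟩ _ ⟨g, hg, rfl⟩
  exact kyFan_le_kyFan_add μ ν
    (by simpa using! (X.lipschitzWith_of_mem_F hf).comp LipschitzWith.prod_fst)
    (by simpa using! (Y.lipschitzWith_of_mem_F hg).comp LipschitzWith.prod_snd)

lemma continuous_dConcCoupling (X Y : GDS) :
    Continuous fun π : ProbabilityMeasure (X.carrier × Y.carrier) => dConcCoupling X Y π := by
  have h : Continuous fun π : LevyProkhorov (ProbabilityMeasure (X.carrier × Y.carrier)) =>
      dConcCoupling X Y π.toMeasure :=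
    continuous_of_le_add_edist 2 (by simp) fun μ ν =>
      dConcCoupling_le_add X Y μ.toMeasure ν.toMeasure
  exact h.comp LevyProkhorov.continuous_ofMeasure_probabilityMeasure

/-- A set of measures on a product is tight if both families of marginals are. -/
lemma isTightMeasureSet_of_map_fst_snd {X Y : Type*} [TopologicalSpace X] [TopologicalSpace Y]
    [MeasurableSpace X] [MeasurableSpace Y] [T2Space X] [T2Space Y]
    [OpensMeasurableSpace X] [OpensMeasurableSpace Y]
    {S : Set (Measure (X × Y))} (hX : IsTightMeasureSet ((·.map Prod.fst) '' S))
    (hY : IsTightMeasureSet ((·.map Prod.snd) '' S)) : IsTightMeasureSet S := by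
  rw [isTightMeasureSet_iff_exists_isCompact_measure_compl_le] at *
  intro ε hε
  obtain ⟨K, hK, hKS⟩ := hX (ε / 2) (ENNReal.half_pos hε.ne')
  obtain ⟨L, hL, hLS⟩ := hY (ε / 2) (ENNReal.half_pos hε.ne')
  refine ⟨K ×ˢ L, hK.prod hL, fun π hπ => ?_⟩
  have hπK := hKS _ ⟨π, hπ, rfl⟩
  have hπL := hLS _ ⟨π, hπ, rfl⟩
  rw [Measure.map_apply measurable_fst hK.measurableSet.compl] at hπK
  rw [Measure.map_apply measurable_snd hL.measurableSet.compl] at hπL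
  calc π (K ×ˢ L)ᶜ ≤ π (Prod.fst ⁻¹' Kᶜ ∪ Prod.snd ⁻¹' Lᶜ) := by
        refine measure_mono fun z hz => ?_
        simp only [Set.mem_compl_iff, Set.mem_prod, not_and_or] at hz
        exact hz
    _ ≤ ε / 2 + ε / 2 := (measure_union_le _ _).trans (add_le_add hπK hπL)
    _ = ε := ENNReal.add_halves ε

lemma isCompact_setOf_coupling (X Y : GDS) :
    IsCompact {π : ProbabilityMeasure (X.carrier × Y.carrier) | X.Coupling Y π} := by
  have h_tight : IsTightMeasureSet {(π : Measure (X.carrier × Y.carrier)) |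
      π ∈ {π : ProbabilityMeasure (X.carrier × Y.carrier) | X.Coupling Y π}} := by
    apply isTightMeasureSet_of_map_fst_snd
    · refine (isTightMeasureSet_singleton (μ := X.μ)).subset ?_
      rintro _ ⟨_, ⟨π, hπ, rfl⟩, rfl⟩
      exact hπ.2.1
    · refine (isTightMeasureSet_singleton (μ := Y.μ)).subset ?_
      rintro _ ⟨_, ⟨π, hπ, rfl⟩, rfl⟩
      exact hπ.2.2
  have h_closed : IsClosed {π : ProbabilityMeasure (X.carrier × Y.carrier) | X.Coupling Y π} := by
    have h_eq : {π : ProbabilityMeasure (X.carrier × Y.carrier) | X.Coupling Y π} =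
        {π | π.map continuous_fst.measurable.aemeasurable = ⟨X.μ, X.prob⟩} ∩
        {π | π.map continuous_snd.measurable.aemeasurable = ⟨Y.μ, Y.prob⟩} := by
      ext π
      exact ⟨fun h => ⟨Subtype.ext h.2.1, Subtype.ext h.2.2⟩,
        fun h => ⟨π.2, congrArg Subtype.val h.1, congrArg Subtype.val h.2⟩⟩
    rw [h_eq]
    exact (isClosed_eq (ProbabilityMeasure.continuous_map continuous_fst) continuous_const).inter
      (isClosed_eq (ProbabilityMeasure.continuous_map continuous_snd) continuous_const)
  simpa [h_closed.closure_eq] using isCompact_closure_of_isTightMeasureSet h_tight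

lemma GDS.coupling_prod (X Y : GDS) : X.Coupling Y (X.μ.prod Y.μ) :=
  ⟨inferInstance, by simp, by simp⟩

lemma GDS.Coupling.of_isParam {X Y : GDS} {φ : Set.Icc (0 : ℝ) 1 → X.carrier}
    {ψ : Set.Icc (0 : ℝ) 1 → Y.carrier} (hφ : IsParam X.μ φ) (hψ : IsParam Y.μ ψ) :
    X.Coupling Y (Measure.map (fun t => (φ t, ψ t)) volume) := by
  have hm := hφ.1.prodMk hψ.1
  refine ⟨Measure.isProbabilityMeasure_map hm.aemeasurable, ?_, ?_⟩
  · rw [Measure.map_map measurable_fst hm]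
    exact hφ.2
  · rw [Measure.map_map measurable_snd hm]
    exact hψ.2

lemma dConc_le_dConcCoupling {X Y : GDS} {π : Measure (X.carrier × Y.carrier)}
    (hπ : X.Coupling Y π) : dConc X Y ≤ dConcCoupling X Y π := by
  have := hπ.1
  have : Nonempty (X.carrier × Y.carrier) := nonempty_of_isProbabilityMeasure π
  obtain ⟨h, hh, h_map⟩ := π.exists_measurable_map_eq
  have hφ : IsParam X.μ (Prod.fst ∘ h) :=
    ⟨measurable_fst.comp hh, by rw [← Measure.map_map measurable_fst hh]; exact h_map ▸ hπ.2.1⟩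
  have hψ : IsParam Y.μ (Prod.snd ∘ h) :=
    ⟨measurable_snd.comp hh, by rw [← Measure.map_map measurable_snd hh]; exact h_map ▸ hπ.2.2⟩
  rw [← h_map, dConcCoupling_map X Y _ hh]
  exact iInf₂_le_of_le _ hφ (iInf₂_le _ hψ)

/-- The observable distance is attained as a minimum over couplings:
`d_conc(X,Y) = min {H_{d_KF^π}(F_X ∘ pr₁, F_Y ∘ pr₂) : π ∈ Π(μ_X, μ_Y)}`. -/
theorem dConc_eq_min_over_couplings (X Y : GDS) :
    ∃ π : Measure (X.carrier × Y.carrier), X.Coupling Y π ∧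
      dConcCoupling X Y π = dConc X Y ∧
      ∀ ρ : Measure (X.carrier × Y.carrier), X.Coupling Y ρ →
        dConc X Y ≤ dConcCoupling X Y ρ := by
  obtain ⟨π, hπ, h_min⟩ := (isCompact_setOf_coupling X Y).exists_isMinOn
    ⟨⟨X.μ.prod Y.μ, inferInstance⟩, X.coupling_prod Y⟩ (continuous_dConcCoupling X Y).continuousOn
  refine ⟨π, hπ, le_antisymm ?_ (dConc_le_dConcCoupling hπ), fun ρ => dConc_le_dConcCoupling⟩
  refine le_iInf₂ fun φ hφ => le_iInf₂ fun ψ hψ => ?_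
  have hc := GDS.Coupling.of_isParam hφ hψ
  have h_le : dConcCoupling X Y π ≤ _ := h_min (a := ⟨_, hc.1⟩) hc
  exact h_le.trans_eq (dConcCoupling_map X Y volume (hφ.1.prodMk hψ.1))
end
end

section
/- Let X, Y, X_n, Y_n (n = 1, 2, …) be geometric data sets. If X_n ⪯ Y_n for every n, d_conc(X_n, X) → 0, and d_conc(Y_n, Y) → 0 as n → ∞, then X ⪯ Y. That is, the feature order relation is preserved under convergence in the observable distance. -/
open MeasureTheory Topology Filter ENNReal

noncomputable section

open scoped ProbabilityTheory in
/-- Gluing: two probability measures with the same image under `u` and `v` admit a coupling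
concentrated on `{(a, b) | u a = v b}`. -/
lemma exists_coupling_of_map_eq {A B Z : Type*} [MeasurableSpace A] [StandardBorelSpace A]
    [Nonempty A] [MeasurableSpace B] [StandardBorelSpace B] [Nonempty B]
    [MeasurableSpace Z] [StandardBorelSpace Z] (μ : Measure A) (ν : Measure B)
    [IsProbabilityMeasure μ] [IsProbabilityMeasure ν] {u : A → Z} {v : B → Z}
    (hu : Measurable u) (hv : Measurable v) (huv : μ.map u = ν.map v) :
    ∃ τ : Measure (A × B), τ.map Prod.fst = μ ∧ τ.map Prod.snd = ν ∧
      ∀ᵐ p ∂τ, u p.1 = v p.2 := by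
  have : IsProbabilityMeasure (μ.map u) := Measure.isProbabilityMeasure_map hu.aemeasurable
  let κ := ProbabilityTheory.condDistrib id u μ
  let η := ProbabilityTheory.condDistrib id v ν
  let σ := (μ.map u) ⊗ₘ (κ ×ₖ η)
  have h1 : σ.map (Prod.map id Prod.fst) = μ.map (fun a => (u a, a)) := by
    rw [← Measure.compProd_map measurable_fst, ← ProbabilityTheory.Kernel.fst_eq,
      ProbabilityTheory.Kernel.fst_prod]
    exact ProbabilityTheory.compProd_map_condDistrib (X := u) (Y := id) aemeasurable_id
  have h2 : σ.map (Prod.map id Prod.snd) = ν.map (fun b => (v b, b)) := by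
    rw [← Measure.compProd_map measurable_snd, ← ProbabilityTheory.Kernel.snd_eq,
      ProbabilityTheory.Kernel.snd_prod, huv]
    exact ProbabilityTheory.compProd_map_condDistrib (X := v) (Y := id) aemeasurable_id
  have e1 : ∀ᵐ q ∂σ, q.1 = u q.2.1 := by
    have hs : MeasurableSet {q : Z × A | q.1 = u q.2} :=
      measurableSet_eq_fun measurable_fst (hu.comp measurable_snd)
    have : ∀ᵐ q ∂(σ.map (Prod.map id Prod.fst)), q.1 = u q.2 := by
      rw [h1, ae_map_iff (by fun_prop) hs]; simp
    exact (ae_map_iff (by fun_prop) hs).1 this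
  have e2 : ∀ᵐ q ∂σ, q.1 = v q.2.2 := by
    have hs : MeasurableSet {q : Z × B | q.1 = v q.2} :=
      measurableSet_eq_fun measurable_fst (hv.comp measurable_snd)
    have : ∀ᵐ q ∂(σ.map (Prod.map id Prod.snd)), q.1 = v q.2 := by
      rw [h2, ae_map_iff (by fun_prop) hs]; simp
    exact (ae_map_iff (by fun_prop) hs).1 this
  refine ⟨σ.map Prod.snd, ?_, ?_, ?_⟩
  · have := congrArg (Measure.map Prod.snd) h1
    rw [Measure.map_map (by fun_prop) (by fun_prop),
      Measure.map_map (by fun_prop) (by fun_prop)] at this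
    rw [Measure.map_map (by fun_prop) (by fun_prop)]
    exact this.trans Measure.map_id
  · have := congrArg (Measure.map Prod.snd) h2
    rw [Measure.map_map (by fun_prop) (by fun_prop),
      Measure.map_map (by fun_prop) (by fun_prop)] at this
    rw [Measure.map_map (by fun_prop) (by fun_prop)]
    exact this.trans Measure.map_id
  · rw [ae_map_iff (by fun_prop) (measurableSet_eq_fun (by fun_prop) (by fun_prop))]
    filter_upwards [e1, e2] with q h h' using h.symm.trans h'

lemma measure_lt_edist_le_of_kyFan_lt {Ω E : Type*} [MeasurableSpace Ω] [PseudoEMetricSpace E]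
    {π : Measure Ω} {u v : Ω → E} {ε : ℝ≥0∞} (h : kyFan π u v < ε) :
    π {ω | ε < edist (u ω) (v ω)} ≤ ε := by
  obtain ⟨δ, hδ, hlt⟩ := sInf_lt_iff.1 h
  exact (measure_mono fun ω hω => hlt.trans hω).trans (le_trans hδ hlt.le)

lemma measure_lt_edist_triangle {Ω E : Type*} [MeasurableSpace Ω] [PseudoEMetricSpace E]
    {π : Measure Ω} {u v w : Ω → E} {ε δ : ℝ≥0∞} (huv : π {ω | ε < edist (u ω) (v ω)} ≤ ε)
    (hvw : π {ω | δ < edist (v ω) (w ω)} ≤ δ) :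
    π {ω | ε + δ < edist (u ω) (w ω)} ≤ ε + δ := by
  refine (measure_mono ?_).trans ((measure_union_le _ _).trans (add_le_add huv hvw))
  intro ω hω
  by_contra hc
  simp only [Set.mem_union, Set.mem_ofPred_eq, not_or, not_lt] at hc hω
  exact absurd hω (not_lt.2 ((edist_triangle _ _ _).trans (add_le_add hc.1 hc.2)))

lemma exists_of_hausd_lt_left {α : Type*} {d : α → α → ℝ≥0∞} {A B : Set α} {ε : ℝ≥0∞}
    (h : hausd d A B < ε) {a : α} (ha : a ∈ A) : ∃ b ∈ B, d a b < ε := by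
  have := (le_iSup (fun a : A => ⨅ b : B, d a b) ⟨a, ha⟩).trans_lt ((le_max_left _ _).trans_lt h)
  obtain ⟨b, hb⟩ := iInf_lt_iff.1 this
  exact ⟨b, b.2, hb⟩

lemma exists_of_hausd_lt_right {α : Type*} {d : α → α → ℝ≥0∞} {A B : Set α} {ε : ℝ≥0∞}
    (h : hausd d A B < ε) {b : α} (hb : b ∈ B) : ∃ a ∈ A, d a b < ε := by
  have := (le_iSup (fun b : B => ⨅ a : A, d a b) ⟨b, hb⟩).trans_lt ((le_max_right _ _).trans_lt h)
  obtain ⟨a, ha⟩ := iInf_lt_iff.1 this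
  exact ⟨a, a.2, ha⟩

namespace GDS

lemma abs_sub_le_dist (X : GDS) {f : X.carrier → ℝ} (hf : f ∈ X.F) (x y : X.carrier) :
    |f x - f y| ≤ dist x y :=
  (X.dist_isLUB x y).1 ⟨f, hf, rfl⟩

lemma continuous_of_mem (X : GDS) {f : X.carrier → ℝ} (hf : f ∈ X.F) : Continuous f :=
  (LipschitzWith.of_dist_le_mul (K := 1) fun x y => by
    simpa [Real.dist_eq] using X.abs_sub_le_dist hf x y).continuous

lemma abs_sub_le_dist_of_mem_closure (X : GDS) {f : X.carrier → ℝ} (hf : f ∈ closure X.F)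
    (x y : X.carrier) : |f x - f y| ≤ dist x y := by
  have hc : IsClosed {f : X.carrier → ℝ | |f x - f y| ≤ dist x y} :=
    isClosed_le (by fun_prop) continuous_const
  exact closure_minimal (fun g hg => X.abs_sub_le_dist hg x y) hc hf

lemma continuous_of_mem_closure (X : GDS) {f : X.carrier → ℝ} (hf : f ∈ closure X.F) :
    Continuous f :=
  (LipschitzWith.of_dist_le_mul (K := 1) fun x y => by
    simpa [Real.dist_eq] using X.abs_sub_le_dist_of_mem_closure hf x y).continuous

/-- Pointwise limits of features are approximated by features in measure. -/
lemma exists_feature_near (X : GDS) {u : X.carrier → ℝ} (hu : u ∈ closure X.F)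
    {ε : ℝ≥0∞} (hε : 0 < ε) : ∃ h ∈ X.F, X.μ {x | ε < edist (u x) (h x)} ≤ ε := by
  obtain ⟨K, hK, hKε⟩ := isTightMeasureSet_iff_exists_isCompact_measure_compl_le.1
    (isTightMeasureSet_singleton (μ := X.μ)) ε hε
  obtain ⟨r, hr0, hrε⟩ := ENNReal.lt_iff_exists_nnreal_btwn.1 hε
  have hr : 0 < (r : ℝ) := by exact_mod_cast hr0
  obtain ⟨t, -, ht, hKt⟩ := hK.finite_cover_balls (e := (r : ℝ) / 3) (by positivity)
  obtain ⟨h, hht, hh⟩ := mem_closure_iff_nhds.1 hu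
    (t.pi fun x => Metric.ball (u x) ((r : ℝ) / 3))
    (set_pi_mem_nhds ht fun x _ => Metric.ball_mem_nhds _ (by positivity))
  refine ⟨h, hh, (measure_mono ?_).trans (hKε X.μ rfl)⟩
  intro x hx hxK
  obtain ⟨y, hy, hxy⟩ := Set.mem_iUnion₂.1 (hKt hxK)
  have h1 := X.abs_sub_le_dist_of_mem_closure hu x y
  have h2 := X.abs_sub_le_dist hh y x
  have h3 : dist (h y) (u y) < r / 3 := hht y hy
  have h4 : dist x y < r / 3 := hxy
  rw [dist_comm y x] at h2
  have h5 : dist (u x) (h x) ≤ r := by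
    rw [← Real.dist_eq] at h1 h2
    rw [dist_comm] at h3
    linarith [dist_triangle4 (u x) (u y) (h y) (h x)]
  have : edist (u x) (h x) ≤ r := by
    rw [edist_dist, ← ENNReal.ofReal_coe_nnreal]
    exact ENNReal.ofReal_le_ofReal h5
  exact absurd (hrε.trans hx) (not_lt.2 this)

lemma exists_params_of_dConc_lt {X Y : GDS} {ε : ℝ≥0∞} (h : dConc X Y < ε) :
    ∃ φ ψ, IsParam X.μ φ ∧ IsParam Y.μ ψ ∧
      hausd (kyFan (volume : Measure (Set.Icc (0:ℝ) 1)))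
        ((· ∘ φ) '' X.F) ((· ∘ ψ) '' Y.F) < ε := by
  simp only [dConc, iInf_lt_iff] at h
  obtain ⟨φ, hφ, ψ, hψ, h⟩ := h
  exact ⟨φ, ψ, hφ, hψ, h⟩

/-- If `W ⪯ Z` and `W`, `Z` are close to `X`, `Y`, then some coupling of `X` and `Y` matches
every feature of `X` with a feature of `Y` approximately. -/
lemma Dominates.exists_coupling {W X Y Z : GDS} (hWZ : Z.Dominates W) {ε : ℝ≥0∞}
    (hX : dConc W X < ε) (hY : dConc Z Y < ε) :
    ∃ π : ProbabilityMeasure (X.carrier × Y.carrier), X.Coupling Y π ∧ ∀ f ∈ X.F, ∃ g ∈ Y.F,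
      (π : Measure (X.carrier × Y.carrier)) {p | ε + ε + ε < edist (f p.1) (g p.2)} ≤ ε + ε + ε := by
  obtain ⟨q, hq, hqμ, hqF⟩ := hWZ
  obtain ⟨φ, φ', hφ, hφ', hφφ'⟩ := exists_params_of_dConc_lt hX
  obtain ⟨ψ, ψ', hψ, hψ', hψψ'⟩ := exists_params_of_dConc_lt hY
  have hε : 0 < ε := pos_of_gt hX
  obtain ⟨τ, hτ1, hτ2, hτ⟩ := exists_coupling_of_map_eq
    (volume : Measure (Set.Icc (0:ℝ) 1)) (volume : Measure (Set.Icc (0:ℝ) 1))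
    (u := φ) (v := q ∘ ψ) hφ.1 (hq.comp hψ.1) (by
      rw [← Measure.map_map hq hψ.1, hψ.2, hqμ, hφ.2])
  have hτp : IsProbabilityMeasure τ := by
    have : IsProbabilityMeasure (τ.map Prod.fst) := by rw [hτ1]; infer_instance
    exact Measure.isProbabilityMeasure_of_map Prod.fst
  have hm : Measurable (fun p : Set.Icc (0:ℝ) 1 × Set.Icc (0:ℝ) 1 => (φ' p.1, ψ' p.2)) :=
    (hφ'.1.comp measurable_fst).prodMk (hψ'.1.comp measurable_snd)
  have hπp := Measure.isProbabilityMeasure_map (μ := τ) hm.aemeasurable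
  refine ⟨⟨τ.map _, hπp⟩, ⟨hπp, ?_, ?_⟩, ?_⟩
  · change (τ.map _).map _ = _
    rw [Measure.map_map measurable_fst hm, ← hφ'.2, ← hτ1, Measure.map_map hφ'.1 measurable_fst]
    rfl
  · change (τ.map _).map _ = _
    rw [Measure.map_map measurable_snd hm, ← hψ'.2, ← hτ2, Measure.map_map hψ'.1 measurable_snd]
    rfl
  intro f hf
  obtain ⟨_, ⟨f', hf', rfl⟩, hff'⟩ := exists_of_hausd_lt_right hφφ' ⟨f, hf, rfl⟩
  have hu := hqF ⟨f', hf', rfl⟩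
  obtain ⟨h, hh, hhu⟩ := Z.exists_feature_near hu hε
  obtain ⟨_, ⟨g, hg, rfl⟩, hgh⟩ := exists_of_hausd_lt_left hψψ' ⟨h, hh, rfl⟩
  refine ⟨g, hg, ?_⟩
  have cf := X.continuous_of_mem hf
  have cg := Y.continuous_of_mem hg
  have cf' := W.continuous_of_mem hf'
  have ch := Z.continuous_of_mem hh
  have cu := Z.continuous_of_mem_closure hu
  have b1 : τ {p | ε < edist (f (φ' p.1)) (f' (φ p.1))} ≤ ε := by
    have := measure_lt_edist_le_of_kyFan_lt hff'
    rw [← hτ1, Measure.map_apply measurable_fst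
      (measurableSet_lt measurable_const ((cf'.measurable.comp hφ.1).edist
        (cf.measurable.comp hφ'.1)))] at this
    simp only [edist_comm (f _)]
    exact this
  have b2 : τ {p | ε < edist (f' (φ p.1)) (h (ψ p.2))} ≤ ε := by
    rw [← hψ.2, Measure.map_apply hψ.1
      (measurableSet_lt measurable_const (cu.measurable.edist ch.measurable)), ← hτ2,
      Measure.map_apply measurable_snd (hψ.1
        (measurableSet_lt measurable_const (cu.measurable.edist ch.measurable)))] at hhu
    refine le_of_eq_of_le (measure_congr ?_) hhu
    filter_upwards [hτ] with p hp
    have hp' : φ p.1 = q (ψ p.2) := hp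
    apply propext
    change ε < edist (f' (φ p.1)) (h (ψ p.2)) ↔ ε < edist (f' (q (ψ p.2))) (h (ψ p.2))
    rw [hp']
  have b3 : τ {p | ε < edist (h (ψ p.2)) (g (ψ' p.2))} ≤ ε := by
    have := measure_lt_edist_le_of_kyFan_lt hgh
    rwa [← hτ2, Measure.map_apply measurable_snd
      (measurableSet_lt measurable_const ((ch.measurable.comp hψ.1).edist
        (cg.measurable.comp hψ'.1)))] at this
  change τ.map _ _ ≤ _
  have hs : MeasurableSet {p : X.carrier × Y.carrier | ε + ε + ε < edist (f p.1) (g p.2)} :=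
    measurableSet_lt measurable_const
      ((cf.measurable.comp measurable_fst).edist (cg.measurable.comp measurable_snd))
  rw [Measure.map_apply hm hs]
  exact measure_lt_edist_triangle (measure_lt_edist_triangle b1 b2) b3

/-- Couplings of `X` and `Y` are compact: along every ultrafilter, they converge weakly. -/
lemma exists_tendsto_coupling {X Y : GDS} {ι : Type*} (U : Ultrafilter ι)
    {π : ι → ProbabilityMeasure (X.carrier × Y.carrier)} (hπ : ∀ i, X.Coupling Y (π i)) :
    ∃ ρ : ProbabilityMeasure (X.carrier × Y.carrier), X.Coupling Y ρ ∧
      Tendsto π U (𝓝 ρ) := by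
  let S : Set (ProbabilityMeasure (X.carrier × Y.carrier)) := Set.range π
  have hS : IsTightMeasureSet
      {((μ : ProbabilityMeasure (X.carrier × Y.carrier)) : Measure (X.carrier × Y.carrier)) | μ ∈ S} := by
    apply IsTightMeasureSet.prodMk
    · refine (isTightMeasureSet_singleton (μ := X.μ)).subset ?_
      rintro _ ⟨_, ⟨_, ⟨i, rfl⟩, rfl⟩, rfl⟩
      exact (hπ i).2.1
    · refine (isTightMeasureSet_singleton (μ := Y.μ)).subset ?_
      rintro _ ⟨_, ⟨_, ⟨i, rfl⟩, rfl⟩, rfl⟩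
      exact (hπ i).2.2
  obtain ⟨ρ, -, hρ⟩ := (isCompact_closure_of_isTightMeasureSet hS).ultrafilter_le_nhds
    (U.map π) (by
      rw [le_principal_iff]
      exact mem_of_superset (Filter.range_mem_map) subset_closure)
  have hlim : Tendsto π U (𝓝 ρ) := hρ
  refine ⟨ρ, ⟨inferInstance, ?_, ?_⟩, hlim⟩
  · have h1 := ProbabilityMeasure.tendsto_map_of_tendsto_of_continuous _ _ hlim continuous_fst
    let ν : ProbabilityMeasure X.carrier := ⟨X.μ, X.prob⟩
    have h2 : ∀ i, (π i).map continuous_fst.measurable.aemeasurable = ν := fun i => Subtype.ext (hπ i).2.1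
    simp only [h2] at h1
    exact congrArg ProbabilityMeasure.toMeasure (tendsto_nhds_unique h1 tendsto_const_nhds)
  · have h1 := ProbabilityMeasure.tendsto_map_of_tendsto_of_continuous _ _ hlim continuous_snd
    let ν : ProbabilityMeasure Y.carrier := ⟨Y.μ, Y.prob⟩
    have h2 : ∀ i, (π i).map continuous_snd.measurable.aemeasurable = ν := fun i => Subtype.ext (hπ i).2.2
    simp only [h2] at h1
    exact congrArg ProbabilityMeasure.toMeasure (tendsto_nhds_unique h1 tendsto_const_nhds)

/-- If features `g i` of `Y` approximate the feature `f` of `X` in measure along weakly convergent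
measures, then `g i` converges to `f` along the support of the limit. -/
lemma tendsto_of_mem_support {X Y : GDS} {ι : Type*} {l : Filter ι}
    {π : ι → ProbabilityMeasure (X.carrier × Y.carrier)}
    {ρ : ProbabilityMeasure (X.carrier × Y.carrier)} (hπ : Tendsto π l (𝓝 ρ))
    {ε : ι → ℝ≥0∞} (hε : Tendsto ε l (𝓝 0)) {f : X.carrier → ℝ} (hf : f ∈ X.F)
    {g : ι → Y.carrier → ℝ} (hg : ∀ i, g i ∈ Y.F)
    (hfg : ∀ i, (π i : Measure (X.carrier × Y.carrier)) {p | ε i < edist (f p.1) (g i p.2)} ≤ ε i)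
    {x : X.carrier} {y : Y.carrier} (hxy : (x, y) ∈ (ρ : Measure (X.carrier × Y.carrier)).support) :
    Tendsto (fun i => g i y) l (𝓝 (f x)) := by
  rw [Metric.tendsto_nhds]
  intro δ hδ
  let G : Set (X.carrier × Y.carrier) := Metric.ball x (δ / 3) ×ˢ Metric.ball y (δ / 3)
  have hGo : IsOpen G := Metric.isOpen_ball.prod Metric.isOpen_ball
  have hG : 0 < (ρ : Measure (X.carrier × Y.carrier)) G := (Measure.mem_support_iff_forall _).1 hxy G
    (hGo.mem_nhds ⟨Metric.mem_ball_self (by positivity), Metric.mem_ball_self (by positivity)⟩)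
  obtain ⟨c, hc0, hcG⟩ := exists_between hG
  have hev := eventually_lt_of_lt_liminf
    (hcG.trans_le (ProbabilityMeasure.le_liminf_measure_open_of_tendsto hπ hGo))
  filter_upwards [hev, hε.eventually_lt_const hc0,
    hε.eventually_lt_const (ENNReal.ofReal_pos.2 (by positivity : 0 < δ / 3))] with i h1 h2 h3
  have hns : ¬ G ⊆ {p | ε i < edist (f p.1) (g i p.2)} := fun hsub =>
    absurd ((measure_mono hsub).trans (hfg i)) (not_le.2 (h2.trans h1))
  obtain ⟨⟨x', y'⟩, ⟨hx', hy'⟩, hp⟩ := Set.not_subset.1 hns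
  have hp' : edist (f x') (g i y') < ENNReal.ofReal (δ / 3) := (not_lt.1 hp).trans_lt h3
  rw [edist_lt_ofReal, Real.dist_eq] at hp'
  have k1 := X.abs_sub_le_dist hf x' x
  have k2 := Y.abs_sub_le_dist (hg i) y' y
  rw [Metric.mem_ball] at hx' hy'
  rw [Real.dist_eq]
  rw [abs_le] at k1 k2
  rw [abs_lt] at hp' ⊢
  constructor <;> linarith [k1.1, k1.2, k2.1, k2.2, hp'.1, hp'.2]

/-- A measure on `X × Y` with `Y`-marginal `μ_Y`, such that every feature of `X` is matched on its
support with a limit of features of `Y`, is carried by the graph of a domination map. -/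
lemma dominates_of_coupling {X Y : GDS} {ρ : Measure (X.carrier × Y.carrier)}
    (hρ : X.Coupling Y ρ) {ι : Type*} {l : Filter ι} [l.NeBot]
    (H : ∀ f ∈ X.F, ∃ g : ι → Y.carrier → ℝ, (∀ i, g i ∈ Y.F) ∧
      ∀ p ∈ ρ.support, Tendsto (fun i => g i p.2) l (𝓝 (f p.1))) :
    Y.Dominates X := by
  obtain ⟨hρp, hρX, hρY⟩ := hρ
  have hdist : ∀ p ∈ ρ.support, ∀ p' ∈ ρ.support, dist p.1 p'.1 ≤ dist p.2 p'.2 := by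
    intro p hp p' hp'
    refine (X.dist_isLUB p.1 p'.1).2 ?_
    rintro _ ⟨f, hf, rfl⟩
    obtain ⟨g, hg, hlim⟩ := H f hf
    exact le_of_tendsto ((hlim p hp).sub (hlim p' hp')).abs
      (Eventually.of_forall fun i => Y.abs_sub_le_dist (hg i) _ _)
  let D : Set Y.carrier := Prod.snd '' ρ.support
  have hD : Dense D := by
    rw [dense_iff_inter_open]
    intro V hV hVne
    have hpos := Y.full_support V hV hVne
    rw [← hρY, Measure.map_apply measurable_snd hV.measurableSet] at hpos
    obtain ⟨p, hpV, hp⟩ := Measure.nonempty_inter_support_of_pos hpos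
    exact ⟨p.2, hpV, p, hp, rfl⟩
  choose s hs hs2 using fun y : D => y.2
  have hsL : LipschitzWith 1 (fun y : D => (s y).1) := LipschitzWith.of_dist_le_mul fun y y' => by
    have := hdist _ (hs y) _ (hs y')
    rw [hs2, hs2] at this
    simpa [Subtype.dist_eq] using this
  have hDr : DenseRange ((↑) : D → Y.carrier) := hD.denseRange_val
  have hDu : IsUniformInducing ((↑) : D → Y.carrier) := isUniformInducing_val D
  let q : Y.carrier → X.carrier := (hDu.isDenseInducing hDr).extend fun y : D => (s y).1
  have hqc : Continuous q :=
    (uniformContinuous_uniformly_extend hDu hDr hsL.uniformContinuous).continuous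
  have hq : ∀ p ∈ ρ.support, q p.2 = p.1 := by
    intro p hp
    have h1 : q p.2 = (s ⟨p.2, p, hp, rfl⟩).1 :=
      uniformly_extend_of_ind hDu hDr hsL.uniformContinuous ⟨p.2, p, hp, rfl⟩
    rw [h1, ← dist_le_zero]
    refine (hdist _ (hs _) _ hp).trans ?_
    rw [hs2, dist_self]
  refine ⟨q, hqc.measurable, ?_, ?_⟩
  · rw [← hρY, ← hρX, Measure.map_map hqc.measurable measurable_snd]
    refine Measure.map_congr ?_
    filter_upwards [Measure.support_mem_ae (μ := ρ)] with p hp using hq p hp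
  · rintro _ ⟨f, hf, rfl⟩
    obtain ⟨g, hg, hlim⟩ := H f hf
    refine mem_closure_of_tendsto (b := l) (f := g) (tendsto_pi_nhds.2 fun y => ?_)
      (Eventually.of_forall hg)
    rw [Metric.tendsto_nhds]
    intro δ hδ
    have hball : ∀ᶠ z in 𝓝 y, dist z y < δ / 3 ∧ dist (q z) (q y) < δ / 3 :=
      (Metric.eventually_nhds_iff_ball.2 ⟨δ / 3, by positivity, fun z hz => hz⟩).and
        (Metric.tendsto_nhds.1 (hqc.tendsto y) (δ / 3) (by positivity))
    obtain ⟨_, ⟨hz1, hz2⟩, p, hp, rfl⟩ := mem_closure_iff_nhds.1 (hD y) _ hball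
    filter_upwards [Metric.tendsto_nhds.1 (hlim p hp) (δ / 3) (by positivity)] with i hi
    rw [hq p hp] at hz2
    have k1 := X.abs_sub_le_dist hf p.1 (q y)
    have k2 := Y.abs_sub_le_dist (hg i) p.2 y
    rw [Real.dist_eq] at hi
    simp only [Function.comp_apply]
    rw [Real.dist_eq]
    rw [abs_le] at k1 k2
    rw [abs_lt] at hi ⊢
    constructor <;> linarith [k1.1, k1.2, k2.1, k2.2, hi.1, hi.2]

end GDS

/-- The feature order is preserved under convergence in the observable
distance: if `X_n ⪯ Y_n`, `d_conc(X_n, X) → 0` and `d_conc(Y_n, Y) → 0`, then `X ⪯ Y`. -/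
theorem dominates_of_dConc_tendsto (X Y : GDS) (Xs Ys : ℕ → GDS)
    (hdom : ∀ n, (Ys n).Dominates (Xs n))
    (hX : Tendsto (fun n => dConc (Xs n) X) atTop (𝓝 0))
    (hY : Tendsto (fun n => dConc (Ys n) Y) atTop (𝓝 0)) :
    Y.Dominates X := by
  let ε : ℕ → ℝ≥0∞ := fun k => ((k : ℝ≥0∞) + 1)⁻¹
  have hεpos : ∀ k, 0 < ε k := fun k => ENNReal.inv_pos.2 (by finiteness)
  have hε0 : Tendsto ε atTop (𝓝 0) := by
    have := (tendsto_add_atTop_iff_nat 1).2 ENNReal.tendsto_inv_nat_nhds_zero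
    simpa [ε] using this
  have hε : Tendsto (fun k => ε k + ε k + ε k) atTop (𝓝 0) := by
    simpa using (hε0.add hε0).add hε0
  have hcoup : ∀ k, ∃ π : ProbabilityMeasure (X.carrier × Y.carrier), X.Coupling Y π ∧
      ∀ f ∈ X.F, ∃ g ∈ Y.F, (π : Measure (X.carrier × Y.carrier)) {p | ε k + ε k + ε k < edist (f p.1) (g p.2)} ≤
        ε k + ε k + ε k := by
    intro k
    obtain ⟨n, h1, h2⟩ := ((hX.eventually_lt_const (hεpos k)).and
      (hY.eventually_lt_const (hεpos k))).exists
    exact (hdom n).exists_coupling h1 h2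
  choose π hπ hπF using hcoup
  obtain ⟨ρ, hρ, hlim⟩ := GDS.exists_tendsto_coupling (hyperfilter ℕ) hπ
  have hle : (hyperfilter ℕ : Filter ℕ) ≤ atTop := Nat.hyperfilter_le_atTop
  refine GDS.dominates_of_coupling hρ (l := (hyperfilter ℕ : Filter ℕ)) fun f hf => ?_
  choose g hg hfg using fun k => hπF k f hf
  exact ⟨g, hg, fun p hp => GDS.tendsto_of_mem_support hlim (hε.mono_left hle) hf hg hfg hp⟩
end
end

section
/- Let X and Y be geometric data sets and π, ρ ∈ Π(μ_X, μ_Y) couplings. Then |□_π(F_X, F_Y) − □_ρ(F_X, F_Y)| ≤ 4 d_P(π, ρ), where d_P is the Prohorov distance on Borel probability measures on X × Y equipped with the l∞-product metric. Consequently (since Π(μ_X, μ_Y) is d_P-compact), the box distance is attained: □(X,Y) = min{□_π(F_X, F_Y) : π ∈ Π(μ_X, μ_Y)}. -/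
open MeasureTheory Topology Filter ENNReal

noncomputable section

instance GDS.secondCountableTopology (X : GDS) : SecondCountableTopology X.carrier :=
  UniformSpace.secondCountable_of_separable X.carrier

namespace BoxDistance

lemma hausd_le_hausd_add {α : Type*} {d d' : α → α → ℝ≥0∞} {A B : Set α} {c : ℝ≥0∞}
    (h : ∀ u ∈ A, ∀ v ∈ B, d' u v ≤ d u v + c) : hausd d' A B ≤ hausd d A B + c := by
  refine max_le (iSup_le fun a ↦ ?_) (iSup_le fun b ↦ ?_)
  · calc ⨅ b : B, d' a b ≤ ⨅ b : B, (d a b + c) := iInf_mono fun b ↦ h a a.2 b b.2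
      _ = (⨅ b : B, d a b) + c := ENNReal.iInf_add.symm
      _ ≤ _ := by
        gcongr
        exact (le_iSup (fun a : A ↦ ⨅ b : B, d a b) a).trans (le_max_left _ _)
  · calc ⨅ a : A, d' a b ≤ ⨅ a : A, (d a b + c) := iInf_mono fun a ↦ h a a.2 b b.2
      _ = (⨅ a : A, d a b) + c := ENNReal.iInf_add.symm
      _ ≤ _ := by
        gcongr
        exact (le_iSup (fun b : B ↦ ⨅ a : A, d a b) b).trans (le_max_right _ _)

lemma dInfty_infEDist_le {Z E : Type*} [PseudoEMetricSpace Z] [PseudoEMetricSpace E]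
    {u v : Z → E} (hu : LipschitzWith 1 u) (hv : LipschitzWith 1 v) (S : Set Z) {ε : ℝ≥0∞}
    (hε : ε ≠ ∞) :
    dInfty {z | Metric.infEDist z S ≤ ε} u v ≤ dInfty S u v + 2 * ε := by
  refine iSup_le fun ⟨z, hz⟩ ↦ ENNReal.le_of_forall_pos_le_add fun δ hδ _ ↦ ?_
  have hδ' : (0 : ℝ≥0∞) < δ / 2 := by simpa using hδ.ne'
  obtain ⟨s, hs, hzs⟩ := Metric.infEDist_lt_iff.1
    (lt_of_le_of_lt hz (ENNReal.lt_add_right hε hδ'.ne'))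
  calc edist (u z) (v z)
      ≤ edist (u z) (u s) + edist (u s) (v s) + edist (v s) (v z) := edist_triangle4 _ _ _ _
    _ ≤ (ε + δ / 2) + dInfty S u v + (ε + δ / 2) := by
        gcongr
        · exact (by simpa using hu z s : _ ≤ edist z s).trans hzs.le
        · exact le_iSup (fun a : S ↦ edist (u a) (v a)) ⟨s, hs⟩
        · exact (by simpa [edist_comm s z] using hv s z : _ ≤ edist z s).trans hzs.le
    _ = dInfty S u v + 2 * ε + (δ / 2 + δ / 2) := by ring
    _ = dInfty S u v + 2 * ε + δ := by rw [ENNReal.add_halves]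

lemma lipschitzWith_feature (X : GDS) {f : X.carrier → ℝ} (hf : f ∈ X.F) :
    LipschitzWith 1 f :=
  LipschitzWith.of_dist_le_mul fun x y ↦ by
    simpa [Real.dist_eq] using (X.dist_isLUB x y).1 ⟨f, hf, rfl⟩

variable {X Y : GDS} {π ρ : Measure (X.carrier × Y.carrier)}

lemma boxCoupling_le_add_of_forall_isClosed {ε : ℝ≥0∞}
    (h : ∀ S, IsClosed S → ρ S ≤ π {z | Metric.infEDist z S < ε} + ε) :
    boxCoupling X Y π X.F Y.F ≤ boxCoupling X Y ρ X.F Y.F + 4 * ε := by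
  rcases eq_or_ne ε ∞ with rfl | hε
  · simp
  simp only [boxCoupling, ENNReal.iInf_add]
  refine le_iInf₂ fun S hS ↦ ?_
  refine (iInf₂_le {z | Metric.infEDist z S ≤ ε}
    (isClosed_le Metric.continuous_infEDist continuous_const)).trans (max_le ?_ ?_)
  · have hle : ρ S ≤ π {z | Metric.infEDist z S ≤ ε} + ε :=
      (h S hS).trans (by gcongr with z; exact fun hz ↦ hz.le)
    calc 1 - π {z | Metric.infEDist z S ≤ ε} ≤ 1 - ρ S + ε := by
          rw [tsub_le_iff_right]
          calc (1 : ℝ≥0∞) ≤ 1 - ρ S + ρ S := le_tsub_add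
            _ ≤ 1 - ρ S + (π {z | Metric.infEDist z S ≤ ε} + ε) := by gcongr
            _ = _ := by ring
      _ ≤ boxS X Y ρ S X.F Y.F + 4 * ε := by
          gcongr
          · exact le_max_left _ _
          · exact le_mul_of_one_le_left' (by norm_num)
  · calc _ ≤ 2 * (hausd (dInfty S) ((· ∘ Prod.fst) '' X.F) ((· ∘ Prod.snd) '' Y.F) + 2 * ε) := by
          gcongr
          refine hausd_le_hausd_add ?_
          rintro _ ⟨f, hf, rfl⟩ _ ⟨g, hg, rfl⟩
          exact dInfty_infEDist_le
            (by simpa using (lipschitzWith_feature X hf).comp LipschitzWith.prod_fst)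
            (by simpa using (lipschitzWith_feature Y hg).comp LipschitzWith.prod_snd) S hε
      _ = 2 * hausd (dInfty S) ((· ∘ Prod.fst) '' X.F) ((· ∘ Prod.snd) '' Y.F) + 4 * ε := by ring
      _ ≤ _ := by gcongr; exact le_max_right _ _

lemma le_add_measure_infEDist_symm {Z : Type*} [PseudoEMetricSpace Z] [MeasurableSpace Z]
    [OpensMeasurableSpace Z] {μ ν : Measure Z} [IsProbabilityMeasure μ] [IsProbabilityMeasure ν]
    {ε : ℝ≥0∞} (h : ∀ A, MeasurableSet A → ν A ≤ μ {z | Metric.infEDist z A < ε} + ε)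
    {A : Set Z} (hA : MeasurableSet A) : μ A ≤ ν {z | Metric.infEDist z A < ε} + ε := by
  set U := {z | Metric.infEDist z A < ε}
  have hU : MeasurableSet U :=
    (isOpen_lt Metric.continuous_infEDist continuous_const).measurableSet
  have hsub : {z | Metric.infEDist z Uᶜ < ε} ⊆ Aᶜ := by
    intro z hz hzA
    obtain ⟨b, hb, hzb⟩ := Metric.infEDist_lt_iff.1 hz
    exact hb (Metric.infEDist_lt_iff.2 ⟨z, hzA, by rwa [edist_comm]⟩)
  calc μ A ≤ μ A + (1 - ν U) - (1 - ν U) := by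
        rw [ENNReal.add_sub_cancel_right (by simp)]
    _ ≤ μ A + (μ Aᶜ + ε) - (1 - ν U) := by
        gcongr
        rw [← prob_compl_eq_one_sub hU]
        exact (h _ hU.compl).trans (by gcongr)
    _ = 1 + ε - (1 - ν U) := by rw [← add_assoc, prob_add_prob_compl hA]
    _ ≤ ν U + ε := by
        rw [tsub_le_iff_right, add_right_comm, add_tsub_cancel_of_le prob_le_one]

lemma le_add_mul_sInf {a b c : ℝ≥0∞} {s : Set ℝ≥0∞} (hc₀ : c ≠ 0) (hc : c ≠ ∞)
    (h : ∀ ε ∈ s, a ≤ b + c * ε) : a ≤ b + c * sInf s := by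
  simp only [sInf_eq_iInf, ENNReal.mul_iInf_of_ne hc₀ hc, ENNReal.add_iInf]
  exact le_iInf₂ h

lemma boxCoupling_le_add_levyProkhorovEDist :
    boxCoupling X Y π X.F Y.F ≤
      boxCoupling X Y ρ X.F Y.F + 4 * levyProkhorovEDist π ρ := by
  refine le_add_mul_sInf (by norm_num) (by norm_num) fun ε h ↦ ?_
  rcases eq_or_ne ε ∞ with rfl | hε
  · simp
  refine boxCoupling_le_add_of_forall_isClosed fun S hS ↦ ?_
  simpa [Metric.thickening, ENNReal.ofReal_toReal hε] using (h S hS.measurableSet).2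

/-- The couplings of `X` and `Y`, with the topology of weak convergence, form a compact set. -/
lemma isCompact_couplings (X Y : GDS) :
    IsCompact {σ : ProbabilityMeasure (X.carrier × Y.carrier) |
      X.Coupling Y (σ : Measure (X.carrier × Y.carrier))} := by
  have hclosed : IsClosed {σ : ProbabilityMeasure (X.carrier × Y.carrier) |
      X.Coupling Y (σ : Measure (X.carrier × Y.carrier))} := by
    have h₁ : IsClosed {σ : ProbabilityMeasure (X.carrier × Y.carrier) |
        σ.map continuous_fst.measurable.aemeasurable =
          (⟨X.μ, X.prob⟩ : ProbabilityMeasure X.carrier)} :=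
      isClosed_eq (ProbabilityMeasure.continuous_map continuous_fst) continuous_const
    have h₂ : IsClosed {σ : ProbabilityMeasure (X.carrier × Y.carrier) |
        σ.map continuous_snd.measurable.aemeasurable =
          (⟨Y.μ, Y.prob⟩ : ProbabilityMeasure Y.carrier)} :=
      isClosed_eq (ProbabilityMeasure.continuous_map continuous_snd) continuous_const
    convert h₁.inter h₂ using 1
    ext σ
    constructor
    · exact fun h ↦ ⟨Subtype.ext h.2.1, Subtype.ext h.2.2⟩
    · exact fun h ↦ ⟨σ.2, congrArg Subtype.val h.1, congrArg Subtype.val h.2⟩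
  rw [← hclosed.closure_eq]
  refine isCompact_closure_of_isTightMeasureSet (IsTightMeasureSet.prodMk ?_ ?_)
  · refine (isTightMeasureSet_singleton (μ := X.μ)).subset ?_
    rintro _ ⟨_, ⟨σ, hσ, rfl⟩, rfl⟩
    exact hσ.2.1
  · refine (isTightMeasureSet_singleton (μ := Y.μ)).subset ?_
    rintro _ ⟨_, ⟨σ, hσ, rfl⟩, rfl⟩
    exact hσ.2.2

lemma continuous_boxCoupling (X Y : GDS) :
    Continuous fun σ : ProbabilityMeasure (X.carrier × Y.carrier) ↦
      boxCoupling X Y (σ : Measure (X.carrier × Y.carrier)) X.F Y.F := by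
  have h : Continuous fun σ : LevyProkhorov (ProbabilityMeasure (X.carrier × Y.carrier)) ↦
      boxCoupling X Y (σ.toMeasure : Measure (X.carrier × Y.carrier)) X.F Y.F :=
    continuous_of_le_add_edist 4 (by norm_num) fun _ _ ↦ boxCoupling_le_add_levyProkhorovEDist
  exact h.comp LevyProkhorov.continuous_ofMeasure_probabilityMeasure

end BoxDistance

open BoxDistance

/-- `|□_π(F_X,F_Y) − □_ρ(F_X,F_Y)| ≤ 4 d_P(π,ρ)` for couplings `π, ρ`;
consequently the box distance is attained by some coupling. -/
theorem boxCoupling_diff_le_prohorov_and_boxDist_attained (X Y : GDS)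
    (π ρ : Measure (X.carrier × Y.carrier))
    (hπ : X.Coupling Y π) (hρ : X.Coupling Y ρ) :
    (boxCoupling X Y π X.F Y.F ≤ boxCoupling X Y ρ X.F Y.F + 4 * prohorov π ρ ∧
     boxCoupling X Y ρ X.F Y.F ≤ boxCoupling X Y π X.F Y.F + 4 * prohorov π ρ) ∧
    ∃ σ : Measure (X.carrier × Y.carrier), X.Coupling Y σ ∧
      boxCoupling X Y σ X.F Y.F = boxDist X Y := by
  have := hπ.1
  have := hρ.1
  refine ⟨⟨le_add_mul_sInf (by norm_num) (by norm_num) fun ε h ↦ ?_,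
    le_add_mul_sInf (by norm_num) (by norm_num) fun ε h ↦ ?_⟩, ?_⟩
  · exact boxCoupling_le_add_of_forall_isClosed fun S hS ↦ h S hS.measurableSet
  · exact boxCoupling_le_add_of_forall_isClosed fun S hS ↦
      le_add_measure_infEDist_symm h hS.measurableSet
  · obtain ⟨σ, hσ, hmin⟩ := (isCompact_couplings X Y).exists_isMinOn ⟨⟨π, hπ.1⟩, hπ⟩
      (continuous_boxCoupling X Y).continuousOn
    exact ⟨σ, hσ, le_antisymm (le_iInf₂ fun τ hτ ↦ hmin (a := ⟨τ, hτ.1⟩) hτ)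
      (iInf₂_le (σ : Measure (X.carrier × Y.carrier)) hσ)⟩
end
end

section
/- The box distance on geometric data sets is complete: if {X_n} is a sequence of geometric data sets that is Cauchy with respect to the box distance □, then there exists a geometric data set X such that □(X_n, X) → 0 as n → ∞. (Moreover, since d_conc ≤ □ and there is an uncountable family of geometric data sets pairwise at d_conc-distance 1, the space of isomorphism classes of geometric data sets with □ is complete but not separable.) -/
open MeasureTheory Topology Filter ENNReal

noncomputable section

section Gluing

open ProbabilityTheory

/-- Gluing lemma: two measures with a common marginal come from a joint law. -/
lemma exists_gluing {α β γ : Type*} [MeasurableSpace α] [MeasurableSpace β] [MeasurableSpace γ]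
    [StandardBorelSpace α] [Nonempty α] [StandardBorelSpace γ] [Nonempty γ]
    (π : Measure (α × β)) (ρ : Measure (β × γ)) [IsProbabilityMeasure π] [IsProbabilityMeasure ρ]
    (h : π.snd = ρ.fst) :
    ∃ P : Measure (β × α × γ), IsProbabilityMeasure P ∧
      P.map (fun p => (p.2.1, p.1)) = π ∧ P.map (fun p => (p.1, p.2.2)) = ρ := by
  have hπ : IsProbabilityMeasure (π.map Prod.swap) :=
    Measure.isProbabilityMeasure_map measurable_swap.aemeasurable
  set κ := (π.map Prod.swap).condKernel
  set η := ρ.condKernel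
  have hfst : (π.map Prod.swap).fst = ρ.fst := by rw [Measure.fst_map_swap, h]
  refine ⟨ρ.fst ⊗ₘ (κ ×ₖ η), inferInstance, ?_, ?_⟩
  · have h1 : ρ.fst ⊗ₘ κ = π.map Prod.swap := by
      rw [← hfst]; exact Measure.disintegrate _ _
    rw [← Kernel.fst_prod κ η, Kernel.fst_eq, Measure.compProd_map measurable_fst] at h1
    have := congrArg (Measure.map Prod.swap) h1
    rw [Measure.map_map measurable_swap measurable_swap,
      Measure.map_map (by fun_prop) (by fun_prop)] at this
    rw [Prod.swap_swap_eq, Measure.map_id] at this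
    exact this
  · have h1 : ρ.fst ⊗ₘ η = ρ := Measure.disintegrate _ _
    rw [← Kernel.snd_prod κ η, Kernel.snd_eq, Measure.compProd_map measurable_snd] at h1
    exact h1

/-- Gluing lemma for sequences: a chain of couplings comes from a joint law. -/
lemma exists_gluing_seq {α : ℕ → Type*} [∀ n, MeasurableSpace (α n)]
    [∀ n, StandardBorelSpace (α n)] [∀ n, Nonempty (α n)]
    (π : ∀ n, Measure (α n × α (n + 1))) [∀ n, IsProbabilityMeasure (π n)]
    (h : ∀ n, (π n).snd = (π (n + 1)).fst) :
    ∃ P : Measure (∀ n, α n), IsProbabilityMeasure P ∧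
      ∀ n, P.map (fun ω => (ω n, ω (n + 1))) = π n := by
  let e : ∀ n, (∀ i : Finset.Iic n, α i) → α n := fun n x => x ⟨n, Finset.mem_Iic.2 le_rfl⟩
  have he : ∀ n, Measurable (e n) := fun n => measurable_pi_apply _
  let κ : ∀ n, Kernel (∀ i : Finset.Iic n, α i) (α (n + 1)) :=
    fun n => (π n).condKernel.comap (e n) (he n)
  have hκ : ∀ n, IsMarkovKernel (κ n) := fun n => by dsimp only [κ]; infer_instance
  let P := Kernel.trajMeasure (π 0).fst κ
  have key : ∀ n, P.map (fun ω => ω n) = (π n).fst →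
      P.map (fun ω => (ω n, ω (n + 1))) = π n := by
    intro n hn
    have h1 := Kernel.map_frestrictLe_trajMeasure_compProd_eq_map_trajMeasure
      (μ₀ := (π 0).fst) (κ := κ) (a := n)
    have h2 := congrArg (Measure.map (Prod.map (e n) id)) h1
    rw [Measure.map_map (by fun_prop) (by fun_prop)] at h2
    have h3 : (Measure.map (Preorder.frestrictLe n) P).map (e n) = (π n).fst := by
      rw [Measure.map_map (by fun_prop) (by fun_prop), ← hn]; rfl
    have h4 : ((Measure.map (Preorder.frestrictLe n) P) ⊗ₘ κ n).map (Prod.map (e n) id)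
        = (π n).fst ⊗ₘ (π n).condKernel := by
      rw [← h3]
      ext s hs
      have hm : MeasurableSet (Prod.map (e n) id ⁻¹' s) := by
        apply hs.preimage; fun_prop
      rw [Measure.map_apply (by fun_prop) hs, Measure.compProd_apply hm, Measure.compProd_apply hs,
        lintegral_map (Kernel.measurable_kernel_prodMk_left hs) (he n)]
      rfl
    rw [h4, Measure.disintegrate] at h2
    exact h2.symm
  refine ⟨P, inferInstance, fun n => key n ?_⟩
  induction n with
  | zero =>
    have h0 : ∀ ν : Measure (∀ i : Finset.Iic 0, α i),
        (Kernel.traj κ 0 ∘ₘ ν).map (Preorder.frestrictLe 0) = ν := by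
      intro ν
      rw [Measure.map_comp _ _ (by fun_prop), Kernel.traj_map_frestrictLe,
        Kernel.partialTraj_self, Measure.id_comp]
    have h1 : P.map (fun ω => ω 0) = (P.map (Preorder.frestrictLe 0)).map (e 0) := by
      rw [Measure.map_map (by fun_prop) (by fun_prop)]; rfl
    refine h1.trans ((congrArg (Measure.map (e 0)) (h0 _)).trans ?_)
    exact (Measure.map_map (he 0) (MeasurableEquiv.measurable _)).trans Measure.map_id
  | succ n ih =>
    have := congrArg Measure.snd (key n ih)
    rw [h, Measure.snd, Measure.map_map (by fun_prop) (by fun_prop)] at this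
    exact this

end Gluing

section BoxDist

instance (X : GDS) : SecondCountableTopology X.carrier :=
  UniformSpace.secondCountable_of_separable X.carrier

instance (X : GDS) : Nonempty X.carrier := nonempty_of_isProbabilityMeasure X.μ

lemma GDS.abs_sub_le_dist_s19 (X : GDS) {f : X.carrier → ℝ} (hf : f ∈ X.F) (x y : X.carrier) :
    |f x - f y| ≤ dist x y :=
  (X.dist_isLUB x y).1 ⟨f, hf, rfl⟩

lemma GDS.continuous_of_mem_s19 (X : GDS) {f : X.carrier → ℝ} (hf : f ∈ X.F) : Continuous f :=
  (LipschitzWith.of_dist_le_mul (K := 1) fun x y => by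
    simpa [Real.dist_eq] using X.abs_sub_le_dist_s19 hf x y).continuous

lemma hausd_le {α : Type*} {d : α → α → ℝ≥0∞} {A B : Set α} {r : ℝ≥0∞}
    (h₁ : ∀ a ∈ A, ∃ b ∈ B, d a b ≤ r) (h₂ : ∀ b ∈ B, ∃ a ∈ A, d a b ≤ r) :
    hausd d A B ≤ r := by
  refine max_le (iSup_le fun a => ?_) (iSup_le fun b => ?_)
  · obtain ⟨b, hb, h⟩ := h₁ a a.2
    exact (iInf_le _ (⟨b, hb⟩ : B)).trans h
  · obtain ⟨a, ha, h⟩ := h₂ b b.2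
    exact (iInf_le _ (⟨a, ha⟩ : A)).trans h

lemma exists_lt_of_hausd_lt_left {α : Type*} {d : α → α → ℝ≥0∞} {A B : Set α} {r : ℝ≥0∞}
    (h : hausd d A B < r) {a : α} (ha : a ∈ A) : ∃ b ∈ B, d a b < r := by
  have := ((le_iSup (fun a : A => ⨅ b : B, d a b) ⟨a, ha⟩).trans (le_max_left _ _)).trans_lt h
  obtain ⟨b, hb⟩ := iInf_lt_iff.1 this
  exact ⟨b, b.2, hb⟩

lemma exists_lt_of_hausd_lt_right {α : Type*} {d : α → α → ℝ≥0∞} {A B : Set α} {r : ℝ≥0∞}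
    (h : hausd d A B < r) {b : α} (hb : b ∈ B) : ∃ a ∈ A, d a b < r := by
  have := ((le_iSup (fun b : B => ⨅ a : A, d a b) ⟨b, hb⟩).trans (le_max_right _ _)).trans_lt h
  obtain ⟨a, ha⟩ := iInf_lt_iff.1 this
  exact ⟨a, a.2, ha⟩

lemma edist_le_ofReal_iff {x y δ : ℝ} (hδ : 0 ≤ δ) :
    edist x y ≤ ENNReal.ofReal δ ↔ |x - y| ≤ δ := by
  rw [edist_dist, Real.dist_eq, ENNReal.ofReal_le_ofReal_iff hδ]

/-- A bound for the box distance from a joint realization of the two measures, on which features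
match up to `δ` outside of a set of measure at most `ε`. -/
lemma boxDist_le {X Y : GDS} {Ω : Type*} [MeasurableSpace Ω] {P : Measure Ω}
    [IsProbabilityMeasure P] {u : Ω → X.carrier} {v : Ω → Y.carrier}
    (hu : Measurable u) (hv : Measurable v) (hPu : P.map u = X.μ) (hPv : P.map v = Y.μ)
    {T : Set Ω} {ε : ℝ≥0∞} {δ : ℝ} (hδ : 0 ≤ δ) (hT : 1 ≤ P T + ε)
    (hδε : 2 * ENNReal.ofReal δ ≤ ε)
    (hXY : ∀ f ∈ X.F, ∃ g ∈ Y.F, ∀ ω ∈ T, |f (u ω) - g (v ω)| ≤ δ)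
    (hYX : ∀ g ∈ Y.F, ∃ f ∈ X.F, ∀ ω ∈ T, |f (u ω) - g (v ω)| ≤ δ) :
    boxDist X Y ≤ ε := by
  let w : Ω → X.carrier × Y.carrier := fun ω => (u ω, v ω)
  have hw : Measurable w := hu.prodMk hv
  have hcoup : X.Coupling Y (P.map w) := by
    refine ⟨Measure.isProbabilityMeasure_map hw.aemeasurable, ?_, ?_⟩
    · rw [Measure.map_map measurable_fst hw, ← hPu]; rfl
    · rw [Measure.map_map measurable_snd hw, ← hPv]; rfl
  have hext : ∀ f ∈ X.F, ∀ g ∈ Y.F, (∀ ω ∈ T, |f (u ω) - g (v ω)| ≤ δ) →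
      dInfty (closure (w '' T)) (f ∘ Prod.fst) (g ∘ Prod.snd) ≤ ENNReal.ofReal δ := by
    intro f hf g hg h
    refine iSup_le fun a => (edist_le_ofReal_iff hδ).2 ?_
    have hcl : IsClosed {p : X.carrier × Y.carrier | |f p.1 - g p.2| ≤ δ} :=
      isClosed_le (((X.continuous_of_mem_s19 hf).comp continuous_fst).sub
        ((Y.continuous_of_mem_s19 hg).comp continuous_snd)).abs continuous_const
    exact closure_minimal (by rintro _ ⟨ω, hω, rfl⟩; exact h ω hω) hcl a.2
  refine (iInf₂_le (P.map w) hcoup).trans ((iInf₂_le (closure (w '' T)) isClosed_closure).trans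
    (max_le ?_ ?_))
  · rw [Measure.map_apply hw isClosed_closure.measurableSet, tsub_le_iff_left]
    refine hT.trans (add_le_add_left (measure_mono fun ω hω => ?_) _)
    exact subset_closure ⟨ω, hω, rfl⟩
  · refine le_trans (mul_le_mul_right (hausd_le ?_ ?_) _) hδε
    · rintro _ ⟨f, hf, rfl⟩
      obtain ⟨g, hg, h⟩ := hXY f hf
      exact ⟨_, ⟨g, hg, rfl⟩, hext f hf g hg h⟩
    · rintro _ ⟨g, hg, rfl⟩
      obtain ⟨f, hf, h⟩ := hYX g hg
      exact ⟨_, ⟨f, hf, rfl⟩, hext f hf g hg h⟩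

lemma exists_coupling_of_boxDist_lt {X Y : GDS} {δ : ℝ} (hδ : 0 ≤ δ)
    (h : boxDist X Y < 2 * ENNReal.ofReal δ) :
    ∃ π, X.Coupling Y π ∧ ∃ S, IsClosed S ∧ 1 < π S + 2 * ENNReal.ofReal δ ∧
      (∀ f ∈ X.F, ∃ g ∈ Y.F, ∀ p ∈ S, |f p.1 - g p.2| ≤ δ) ∧
      (∀ g ∈ Y.F, ∃ f ∈ X.F, ∀ p ∈ S, |f p.1 - g p.2| ≤ δ) := by
  obtain ⟨π, h⟩ := iInf_lt_iff.1 h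
  obtain ⟨hπ, h⟩ := iInf_lt_iff.1 h
  obtain ⟨S, h⟩ := iInf_lt_iff.1 h
  obtain ⟨hS, h⟩ := iInf_lt_iff.1 h
  have h1 := (le_max_left _ _).trans_lt h
  have h2 := (le_max_right _ _).trans_lt h
  have h2 := lt_of_mul_lt_mul_left' h2
  have := hπ.1
  have hle : ∀ {f : X.carrier → ℝ} {g : Y.carrier → ℝ},
      dInfty S (f ∘ Prod.fst) (g ∘ Prod.snd) < ENNReal.ofReal δ → ∀ p ∈ S, |f p.1 - g p.2| ≤ δ :=
    fun {f g} h p hp => (edist_le_ofReal_iff hδ).1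
      ((le_iSup (fun a : S => edist ((f ∘ Prod.fst) (a : X.carrier × Y.carrier))
        ((g ∘ Prod.snd) (a : X.carrier × Y.carrier))) ⟨p, hp⟩).trans h.le)
  refine ⟨π, hπ, S, hS, ?_, fun f hf => ?_, fun g hg => ?_⟩
  · by_contra! hc
    exact absurd h1 (not_lt.2 (ENNReal.le_sub_of_add_le_left (measure_ne_top _ _) hc))
  · obtain ⟨_, ⟨g, hg, rfl⟩, h⟩ := exists_lt_of_hausd_lt_left h2 (Set.mem_image_of_mem _ hf)
    exact ⟨g, hg, hle h⟩
  · obtain ⟨_, ⟨f, hf, rfl⟩, h⟩ := exists_lt_of_hausd_lt_right h2 (Set.mem_image_of_mem _ hg)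
    exact ⟨f, hf, hle h⟩

lemma one_le_measure_inter_add {Ω : Type*} [MeasurableSpace Ω] {P : Measure Ω}
    [IsProbabilityMeasure P] {A B : Set Ω} {a b : ℝ≥0∞} (hA : MeasurableSet A)
    (hB : MeasurableSet B) (ha : 1 ≤ P A + a) (hb : 1 ≤ P B + b) :
    1 ≤ P (A ∩ B) + (a + b) := by
  have hA' : P Aᶜ ≤ a := by
    rw [prob_compl_eq_one_sub hA]; exact tsub_le_iff_left.2 ha
  have hB' : P Bᶜ ≤ b := by
    rw [prob_compl_eq_one_sub hB]; exact tsub_le_iff_left.2 hb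
  rw [← tsub_le_iff_left, ← prob_compl_eq_one_sub (hA.inter hB), Set.compl_inter]
  exact (measure_union_le _ _).trans (add_le_add hA' hB')

/-- The triangle inequality for the box distance. -/
lemma boxDist_lt_add {X Y Z : GDS} {a b : ℝ} (ha : 0 ≤ a) (hb : 0 ≤ b)
    (hXY : boxDist X Y < 2 * ENNReal.ofReal a) (hYZ : boxDist Y Z < 2 * ENNReal.ofReal b) :
    boxDist X Z ≤ 2 * ENNReal.ofReal (a + b) := by
  obtain ⟨π, ⟨hπ, hπX, hπY⟩, S, hS, hSm, hS1, hS2⟩ := exists_coupling_of_boxDist_lt ha hXY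
  obtain ⟨ρ, ⟨hρ, hρY, hρZ⟩, R, hR, hRm, hR1, hR2⟩ := exists_coupling_of_boxDist_lt hb hYZ
  obtain ⟨P, hP, hP1, hP2⟩ := exists_gluing π ρ (hπY.trans hρY.symm)
  set p : Y.carrier × X.carrier × Z.carrier → X.carrier × Y.carrier := fun p => (p.2.1, p.1)
  set q : Y.carrier × X.carrier × Z.carrier → Y.carrier × Z.carrier := fun p => (p.1, p.2.2)
  have hp : Measurable p := by fun_prop
  have hq : Measurable q := by fun_prop
  rw [← hP1, Measure.map_apply hp hS.measurableSet] at hSm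
  rw [← hP2, Measure.map_apply hq hR.measurableSet] at hRm
  refine boxDist_le (P := P) (u := fun p => p.2.1) (v := fun p => p.2.2) (by fun_prop)
    (by fun_prop) ?_ ?_ (add_nonneg ha hb) (T := p ⁻¹' S ∩ q ⁻¹' R)
    ?_ le_rfl ?_ ?_
  · rw [← hπX, ← hP1, Measure.map_map measurable_fst hp]; rfl
  · rw [← hρZ, ← hP2, Measure.map_map measurable_snd hq]; rfl
  · rw [ENNReal.ofReal_add ha hb, mul_add]
    exact one_le_measure_inter_add (hp hS.measurableSet) (hq hR.measurableSet) hSm.le hRm.le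
  · intro f hf
    obtain ⟨g, hg, h⟩ := hS1 f hf
    obtain ⟨k, hk, h'⟩ := hR1 g hg
    exact ⟨k, hk, fun ω hω => (abs_sub_le _ _ _).trans (add_le_add (h _ hω.1) (h' _ hω.2))⟩
  · intro k hk
    obtain ⟨g, hg, h⟩ := hR2 k hk
    obtain ⟨f, hf, h'⟩ := hS2 g hg
    exact ⟨f, hf, fun ω hω => (abs_sub_le _ _ _).trans (add_le_add (h' _ hω.1) (h _ hω.2))⟩

end BoxDist

section NotSeparable

/-- The one-point data set with constant features. -/
def GDS.point (C : Set ℝ) (hC : C.Nonempty) : GDS where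
  carrier := Unit
  met := inferInstance
  cms := inferInstance
  sep := inferInstance
  msp := inferInstance
  bor := inferInstance
  F := (fun c _ => c) '' C
  F_nonempty := hC.image _
  dist_isLUB x y := by
    rw [Set.image_image]
    simp [hC.image_const]
  μ := Measure.dirac ()
  prob := inferInstance
  full_support U _ hU := by
    obtain ⟨x, hx⟩ := hU
    have : U = Set.univ := Set.eq_univ_of_forall fun y => by rwa [Subsingleton.elim y x]
    simp [this]

lemma GDS.point_subset_of_boxDist_lt {C D : Set ℕ}
    {hC : ((↑) '' C : Set ℝ).Nonempty} {hD : ((↑) '' D : Set ℝ).Nonempty} {Y : GDS}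
    (h₁ : boxDist (GDS.point _ hC) Y < 2 * ENNReal.ofReal (1 / 8))
    (h₂ : boxDist (GDS.point _ hD) Y < 2 * ENNReal.ofReal (1 / 8)) : C ⊆ D := by
  obtain ⟨π, ⟨hπ, -, hπY⟩, S, hS, hSm, hS1, -⟩ := exists_coupling_of_boxDist_lt (by norm_num) h₁
  obtain ⟨ρ, ⟨hρ, -, hρY⟩, R, hR, hRm, -, hR2⟩ := exists_coupling_of_boxDist_lt (by norm_num) h₂
  have key : ∀ (E : Set ℝ) (hE : E.Nonempty) (π : Measure ((GDS.point E hE).carrier × Y.carrier))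
      (_ : π.map Prod.snd = Y.μ) (S : Set ((GDS.point E hE).carrier × Y.carrier))
      (_ : IsClosed S), MeasurableSet {y : Y.carrier | ((), y) ∈ S} ∧
        Y.μ {y : Y.carrier | ((), y) ∈ S} = π S := by
    intro E hE π hπ S hS
    have hm : MeasurableSet {y : Y.carrier | ((), y) ∈ S} :=
      (hS.preimage (f := fun y : Y.carrier => (((), y) : (GDS.point E hE).carrier × Y.carrier))
        (by fun_prop)).measurableSet
    refine ⟨hm, ?_⟩
    rw [← hπ, Measure.map_apply measurable_snd hm]
    rfl
  obtain ⟨hm1, he1⟩ := key _ hC π hπY S hS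
  obtain ⟨hm2, he2⟩ := key _ hD ρ hρY R hR
  rw [← he1] at hSm
  rw [← he2] at hRm
  have hpos := one_le_measure_inter_add hm1 hm2 hSm.le hRm.le
  have hne : Y.μ ({y | ((), y) ∈ S} ∩ {y | ((), y) ∈ R}) ≠ 0 := by
    intro h0
    have : 2 * ENNReal.ofReal (1 / 8) + 2 * ENNReal.ofReal (1 / 8) = ENNReal.ofReal (1 / 2) := by
      rw [← ENNReal.ofReal_ofNat, ← ENNReal.ofReal_mul (by norm_num),
        ← ENNReal.ofReal_add (by norm_num) (by norm_num)]
      norm_num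
    rw [h0, zero_add, this, ← ENNReal.ofReal_one, ENNReal.ofReal_le_ofReal_iff (by norm_num)]
      at hpos
    norm_num at hpos
  obtain ⟨y, hyS, hyR⟩ := nonempty_of_measure_ne_zero hne
  intro c hc
  obtain ⟨g, hg, h⟩ := hS1 (fun _ => (c : ℝ)) ⟨c, ⟨c, hc, rfl⟩, rfl⟩
  obtain ⟨_, ⟨_, ⟨d, hd, rfl⟩, rfl⟩, h'⟩ := hR2 g hg
  have hcd : |(c : ℝ) - d| < 1 := by
    have e1 := h _ hyS
    have e2 := h' _ hyR
    rw [abs_le] at e1 e2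
    dsimp only at e1 e2
    rw [abs_lt]
    constructor <;> linarith
  have : c = d := by
    have h1 : |(c : ℤ) - d| < 1 := by exact_mod_cast hcd
    have := Int.abs_lt_one_iff.1 h1
    omega
  exact this ▸ hd

lemma not_exists_countable_dense_boxDist :
    ¬ ∃ D : Set GDS, D.Countable ∧
        ∀ X : GDS, ∀ ε : ℝ≥0∞, 0 < ε → ∃ Y ∈ D, boxDist X Y < ε := by
  rintro ⟨D, hD, h⟩
  let C' : Set ℕ → Set ℕ := fun C => insert 0 (Nat.succ '' C)
  have hne : ∀ C, ((↑) '' C' C : Set ℝ).Nonempty := fun C => (Set.insert_nonempty _ _).image _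
  choose φ hφD hφ using fun C => h (GDS.point _ (hne C)) (2 * ENNReal.ofReal (1 / 8)) (by simp)
  have hsub : ∀ C₁ C₂, φ C₁ = φ C₂ → C₁ ⊆ C₂ := by
    intro C₁ C₂ he c hc
    have h₂ := hφ C₂
    rw [← he] at h₂
    simpa [C'] using GDS.point_subset_of_boxDist_lt (hφ C₁) h₂
      (show c + 1 ∈ C' C₁ from Or.inr ⟨c, hc, rfl⟩)
  have hinj : Function.Injective fun C => (⟨φ C, hφD C⟩ : D) := fun C₁ C₂ he =>
    have he := congrArg Subtype.val he
    (hsub _ _ he).antisymm (hsub _ _ he.symm)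
  have := hD.to_subtype
  have := hinj.countable
  obtain ⟨f, hf⟩ := exists_injective_nat (Set ℕ)
  exact Function.cantor_injective f hf

end NotSeparable

section Realization

/-- A probability measure on a complete separable metric space whose distance is induced by a
family of features gives a geometric data set, carried by the support of the measure. -/
lemma exists_gds_support {Z I : Type} [MetricSpace Z] [CompleteSpace Z]
    [SecondCountableTopology Z] [MeasurableSpace Z] [BorelSpace Z] [Nonempty I]
    (ν : Measure Z) [IsProbabilityMeasure ν] (e : I → Z → ℝ)
    (he : ∀ x y, IsLUB (Set.range fun i => |e i x - e i y|) (dist x y)) :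
    ∃ (X : GDS) (ρ : Z → X.carrier) (e' : I → X.carrier → ℝ), Measurable ρ ∧ ν.map ρ = X.μ ∧
      X.F = Set.range e' ∧ ∀ᵐ z ∂ν, ∀ i, e' i (ρ z) = e i z := by
  classical
  have hcl : IsClosed ν.support := Measure.isClosed_support
  have hfull : ∀ᵐ z ∂ν, z ∈ ν.support := Measure.support_mem_ae
  obtain ⟨z₀, hz₀⟩ := hfull.exists
  let ρ : Z → ν.support := fun z => if h : z ∈ ν.support then ⟨z, h⟩ else ⟨z₀, hz₀⟩
  have hρ : Measurable ρ := Measurable.dite measurable_id measurable_const hcl.measurableSet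
  have hρ_eq : ∀ z ∈ ν.support, (ρ z : Z) = z := fun z hz => by simp [ρ, hz]
  let X : GDS :=
    { carrier := ν.support
      met := inferInstance
      cms := hcl.completeSpace_coe
      sep := inferInstance
      msp := inferInstance
      bor := inferInstance
      F := Set.range fun (i : I) (z : ν.support) => e i z
      F_nonempty := Set.range_nonempty _
      dist_isLUB := fun x y => by
        rw [← Set.range_comp]
        exact he x y
      μ := ν.map ρ
      prob := Measure.isProbabilityMeasure_map hρ.aemeasurable
      full_support := by
        rintro U hU ⟨x, hx⟩
        rw [Measure.map_apply hρ hU.measurableSet]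
        obtain ⟨V, hV, rfl⟩ := isOpen_induced_iff.1 hU
        refine ((Measure.mem_support_iff_forall _).1 x.2 V (hV.mem_nhds hx)).trans_le
          (measure_mono_ae ?_)
        filter_upwards [hfull] with z hz hzV
        change (ρ z : Z) ∈ V
        rwa [hρ_eq z hz] }
  refine ⟨X, ρ, fun i z => e i z.1, hρ, rfl, rfl, ?_⟩
  filter_upwards [hfull] with z hz i
  rw [hρ_eq z hz]

/-- A family of features on a probability space, inducing a separable pseudometric with measurable
balls on a set of full measure, is realized by a geometric data set. -/
lemma exists_gds_of_features {Ω I : Type} [MeasurableSpace Ω] [Nonempty I] (P : Measure Ω)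
    [IsProbabilityMeasure P] {T : Set Ω} (hT : MeasurableSet T) (hPT : ∀ᵐ ω ∂P, ω ∈ T)
    (g : I → Ω → ℝ)
    (hbdd : ∀ ω ∈ T, ∀ ω' ∈ T, ∃ C, ∀ i, |g i ω - g i ω'| ≤ C)
    (hmeas : ∀ ω' ∈ T, ∀ r, MeasurableSet {ω | ω ∈ T ∧ ∀ i, |g i ω - g i ω'| ≤ r})
    (hsep : ∀ ε > 0, ∃ D ⊆ T, D.Countable ∧ ∀ ω ∈ T, ∃ ω' ∈ D, ∀ i, |g i ω - g i ω'| ≤ ε) :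
    ∃ (X : GDS) (Ψ : Ω → X.carrier) (e : I → X.carrier → ℝ), Measurable Ψ ∧ P.map Ψ = X.μ ∧
      X.F = Set.range e ∧ ∀ᵐ ω ∂P, ∀ i, e i (Ψ ω) = g i ω := by
  classical
  obtain ⟨ω₀, hω₀⟩ := hPT.exists
  let E := lp (fun _ : I => ℝ) ⊤
  have hmem : ∀ ω ∈ T, Memℓp (fun i => g i ω - g i ω₀) ⊤ := fun ω hω => by
    obtain ⟨C, hC⟩ := hbdd ω hω ω₀ hω₀
    exact memℓp_infty ⟨C, by rintro _ ⟨i, rfl⟩; exact hC i⟩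
  let Φ : T → E := fun ω => ⟨fun i => g i ω - g i ω₀, hmem ω ω.2⟩
  have hlub : ∀ x y : E, IsLUB (Set.range fun i => |x i - y i|) (dist x y) := fun x y => by
    rw [dist_eq_norm]
    exact lp.isLUB_norm (x - y)
  have hdist : ∀ (ω ω' : T) (r : ℝ), dist (Φ ω) (Φ ω') ≤ r ↔ ∀ i, |g i ω - g i ω'| ≤ r := by
    intro ω ω' r
    rw [isLUB_le_iff (hlub _ _)]
    simp [upperBounds, Φ]
  have hsepΦ : TopologicalSpace.IsSeparable (Set.range Φ) := by
    choose! D hDT hD hDd using hsep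
    refine ⟨⋃ n : ℕ, Φ '' (Subtype.val ⁻¹' D (1 / ((n : ℝ) + 1))), ?_, ?_⟩
    · exact Set.countable_iUnion fun n =>
        ((hD _ Nat.one_div_pos_of_nat).preimage Subtype.val_injective).image _
    · rintro _ ⟨ω, rfl⟩
      refine Metric.mem_closure_iff.2 fun ε hε => ?_
      obtain ⟨n, hn⟩ := exists_nat_one_div_lt hε
      obtain ⟨ω', hω', h⟩ := hDd (1 / ((n : ℝ) + 1)) Nat.one_div_pos_of_nat ω ω.2
      exact ⟨Φ ⟨ω', hDT _ Nat.one_div_pos_of_nat hω'⟩,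
        Set.mem_iUnion.2 ⟨n, _, hω', rfl⟩, ((hdist _ _ _).2 h).trans_lt hn⟩
  let Z := closure (Set.range Φ)
  have : SecondCountableTopology Z := by
    have : TopologicalSpace.SeparableSpace Z := hsepΦ.closure.separableSpace
    exact UniformSpace.secondCountable_of_separable Z
  have : CompleteSpace Z := isClosed_closure.completeSpace_coe
  let _ : MeasurableSpace Z := borel Z
  have : BorelSpace Z := ⟨rfl⟩
  let Ψ : Ω → Z := fun ω => if h : ω ∈ T then ⟨Φ ⟨ω, h⟩, subset_closure ⟨_, rfl⟩⟩
    else ⟨Φ ⟨ω₀, hω₀⟩, subset_closure ⟨_, rfl⟩⟩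
  have hball : ∀ (ω' : T) (r : ℝ), MeasurableSet {ω : T | dist (Φ ω) (Φ ω') < r} := by
    intro ω' r
    have : {ω : T | dist (Φ ω) (Φ ω') < r} =
        ⋃ n : ℕ, Subtype.val ⁻¹' {ω | ω ∈ T ∧ ∀ i, |g i ω - g i ω'| ≤ r - 1 / ((n : ℝ) + 1)} := by
      ext ω
      simp only [Set.mem_ofPred_eq, Set.mem_iUnion, Set.mem_preimage, ω.2, true_and, ← hdist]
      refine ⟨fun h => ?_, fun ⟨n, hn⟩ => ?_⟩
      · obtain ⟨n, hn⟩ := exists_nat_one_div_lt (sub_pos.2 h)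
        exact ⟨n, by linarith⟩
      · have : 0 < 1 / ((n : ℝ) + 1) := Nat.one_div_pos_of_nat
        linarith
    rw [this]
    exact MeasurableSet.iUnion fun n => measurable_subtype_coe (hmeas ω' ω'.2 _)
  have hΦ : Measurable fun ω : T => (⟨Φ ω, subset_closure ⟨_, rfl⟩⟩ : Z) := by
    refine measurable_of_isOpen fun U hU => ?_
    let ι := {p : T × ℝ // Metric.ball (⟨Φ p.1, subset_closure ⟨_, rfl⟩⟩ : Z) p.2 ⊆ U}
    obtain ⟨J, hJ, hJU⟩ := TopologicalSpace.isOpen_iUnion_countable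
      (fun p : ι => Metric.ball (⟨Φ p.1.1, subset_closure ⟨_, rfl⟩⟩ : Z) p.1.2)
      (fun _ => Metric.isOpen_ball)
    have hUJ : (fun ω : T => (⟨Φ ω, subset_closure ⟨_, rfl⟩⟩ : Z)) ⁻¹' U =
        ⋃ p ∈ J, {ω : T | dist (Φ ω) (Φ p.1.1) < p.1.2} := by
      ext ω
      have := Set.ext_iff.1 hJU ⟨Φ ω, subset_closure ⟨_, rfl⟩⟩
      simp only [Set.mem_iUnion, Metric.mem_ball, Subtype.dist_eq, exists_prop] at this
      simp only [Set.mem_iUnion, Set.mem_preimage, Set.mem_ofPred_eq, exists_prop]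
      rw [this]
      refine ⟨fun h => ?_, fun ⟨p, hp⟩ => p.2 (by simpa [Subtype.dist_eq] using hp)⟩
      obtain ⟨r, hr, hrU⟩ := Metric.isOpen_iff.1 hU _ h
      exact ⟨⟨(ω, r), hrU⟩, by simpa using hr⟩
    exact hUJ ▸ MeasurableSet.biUnion hJ fun p _ => hball _ _
  have hΨ : Measurable Ψ := Measurable.dite hΦ measurable_const hT
  have := Measure.isProbabilityMeasure_map (μ := P) hΨ.aemeasurable
  obtain ⟨X, ρ, e, hρ, hX, hF, he⟩ := exists_gds_support (P.map Ψ)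
    (fun (i : I) (z : Z) => (z : E) i + g i ω₀) (fun x y => by
      simp only [add_sub_add_right_eq_sub]; exact hlub x y)
  refine ⟨X, ρ ∘ Ψ, e, hρ.comp hΨ, ?_, hF, ?_⟩
  · rw [← hX, Measure.map_map hρ hΨ]
  · filter_upwards [ae_of_ae_map hΨ.aemeasurable he, hPT] with ω h hω i
    rw [Function.comp_apply, h]
    simp [Ψ, hω, Φ]

end Realization

section Completeness

/-- If the features of a sequence of data sets, realized on one probability space, are uniformly
approximated by a family of limit features on large sets, then the sequence has a box limit. -/
lemma exists_boxDist_le_of_features {X : ℕ → GDS} {Ω I : Type} [MeasurableSpace Ω] [Nonempty I]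
    {P : Measure Ω} [IsProbabilityMeasure P] {u : ∀ k, Ω → (X k).carrier}
    (hu : ∀ k, Measurable (u k)) (hPu : ∀ k, P.map (u k) = (X k).μ) {T : ℕ → Set Ω}
    (hT : Monotone T) (hTm : ∀ k, MeasurableSet (T k)) {η : ℕ → ℝ} (hη₀ : ∀ k, 0 ≤ η k)
    (hη : Tendsto η atTop (𝓝 0)) (hPT : ∀ k, P (T k)ᶜ ≤ 2 * ENNReal.ofReal (η k))
    {g : I → Ω → ℝ}
    (hfg : ∀ k, ∀ f ∈ (X k).F, ∃ i, ∀ ω ∈ T k, |f (u k ω) - g i ω| ≤ η k)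
    (hgf : ∀ k i, ∃ f ∈ (X k).F, ∀ ω ∈ T k, |f (u k ω) - g i ω| ≤ η k) :
    ∃ Y : GDS, ∀ k, boxDist (X k) Y ≤ 2 * ENNReal.ofReal (η k) := by
  have hlim : Tendsto (fun k => 2 * η k) atTop (𝓝 0) := by simpa using hη.const_mul 2
  have hsmall : ∀ ε > 0, ∃ K, ∀ k ≥ K, 2 * η k ≤ ε := fun ε hε =>
    eventually_atTop.1 (hlim.eventually_le_const hε)
  have hupper : ∀ k, ∀ ω ∈ T k, ∀ ω' ∈ T k, ∀ i,
      |g i ω - g i ω'| ≤ dist (u k ω) (u k ω') + 2 * η k := by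
    intro k ω hω ω' hω' i
    obtain ⟨f, hf, h⟩ := hgf k i
    have h1 := abs_le.1 (h ω hω)
    have h2 := abs_le.1 (h ω' hω')
    have h3 := abs_le.1 ((X k).abs_sub_le_dist_s19 hf (u k ω) (u k ω'))
    rw [abs_le]
    constructor <;> linarith
  have hlower : ∀ k, ∀ ω ∈ T k, ∀ ω' ∈ T k, ∀ r, (∀ i, |g i ω - g i ω'| ≤ r) →
      dist (u k ω) (u k ω') ≤ r + 2 * η k := by
    intro k ω hω ω' hω' r hr
    refine ((X k).dist_isLUB _ _).2 ?_
    rintro _ ⟨f, hf, rfl⟩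
    obtain ⟨i, h⟩ := hfg k f hf
    have h1 := abs_le.1 (h ω hω)
    have h2 := abs_le.1 (h ω' hω')
    have h3 := abs_le.1 (hr i)
    dsimp only
    rw [abs_le]
    constructor <;> linarith
  have hcommon : ∀ ω ∈ ⋃ k, T k, ∀ ω' ∈ ⋃ k, T k, ∃ N, ∀ k ≥ N, ω ∈ T k ∧ ω' ∈ T k := by
    intro ω hω ω' hω'
    obtain ⟨m, hm⟩ := Set.mem_iUnion.1 hω
    obtain ⟨n, hn⟩ := Set.mem_iUnion.1 hω'
    exact ⟨max m n, fun k hk => ⟨hT (le_of_max_le_left hk) hm, hT (le_of_max_le_right hk) hn⟩⟩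
  have hTU : MeasurableSet (⋃ k, T k) := MeasurableSet.iUnion hTm
  have hfull : ∀ᵐ ω ∂P, ω ∈ ⋃ k, T k := by
    have h0 : Tendsto (fun k => 2 * ENNReal.ofReal (η k)) atTop (𝓝 0) := by
      simpa using ENNReal.Tendsto.const_mul (ENNReal.tendsto_ofReal hη)
        (Or.inr (by norm_num : (2 : ℝ≥0∞) ≠ ⊤))
    refine le_antisymm (ge_of_tendsto' h0 fun k => (measure_mono ?_).trans (hPT k)) zero_le
    exact Set.compl_subset_compl.2 (Set.subset_iUnion T k)
  have hmeas : ∀ ω' ∈ ⋃ k, T k, ∀ r,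
      MeasurableSet {ω | ω ∈ ⋃ k, T k ∧ ∀ i, |g i ω - g i ω'| ≤ r} := by
    intro ω' hω' r
    have : {ω | ω ∈ ⋃ k, T k ∧ ∀ i, |g i ω - g i ω'| ≤ r} = (⋃ k, T k) ∩ ⋂ m : ℕ, ⋃ K : ℕ,
        ⋂ k ≥ K, {ω | dist (u k ω) (u k ω') ≤ r + 1 / ((m : ℝ) + 1)} := by
      ext ω
      simp only [Set.mem_inter_iff, Set.mem_ofPred_eq, Set.mem_iInter,
        Set.mem_iUnion (s := fun K : ℕ => ⋂ k ≥ K, {ω | dist (u k ω) (u k ω') ≤ r + _})]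
      refine and_congr_right fun hω => ?_
      obtain ⟨N, hN⟩ := hcommon ω hω ω' hω'
      constructor
      · intro h m
        obtain ⟨K, hK⟩ := hsmall (1 / ((m : ℝ) + 1)) Nat.one_div_pos_of_nat
        refine ⟨max K N, fun k hk => ?_⟩
        obtain ⟨h1, h2⟩ := hN k (le_of_max_le_right hk)
        exact (hlower k ω h1 ω' h2 r h).trans (by linarith [hK k (le_of_max_le_left hk)])
      · intro h i
        refine le_of_forall_pos_le_add fun ε hε => ?_
        obtain ⟨m, hm⟩ := exists_nat_one_div_lt (half_pos hε)
        obtain ⟨K, hK⟩ := h m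
        obtain ⟨L, hL⟩ := hsmall (ε / 2) (half_pos hε)
        let k := max K (max L N)
        have hk : k ≥ K ∧ k ≥ L ∧ k ≥ N := by omega
        obtain ⟨h1, h2⟩ := hN k hk.2.2
        linarith [hupper k ω h1 ω' h2 i, hK k hk.1, hL k hk.2.1]
    rw [this]
    refine hTU.inter (MeasurableSet.iInter fun m => MeasurableSet.iUnion fun K =>
      MeasurableSet.iInter fun k => MeasurableSet.iInter fun _ => ?_)
    exact measurableSet_le ((hu k).dist measurable_const) measurable_const
  have hsep : ∀ ε > 0, ∃ D ⊆ ⋃ k, T k, D.Countable ∧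
      ∀ ω ∈ ⋃ k, T k, ∃ ω' ∈ D, ∀ i, |g i ω - g i ω'| ≤ ε := by
    intro ε hε
    have hn : ∀ n, ∃ D ⊆ T n, D.Countable ∧ ∀ ω ∈ T n, ∃ ω' ∈ D, ∀ i, |g i ω - g i ω'| ≤ ε := by
      intro n
      obtain ⟨K, hK⟩ := hsmall (ε / 2) (half_pos hε)
      let k := max K n
      have hTk : T n ⊆ T k := hT (le_max_right _ _)
      obtain ⟨C, hCs, hC, hCd⟩ := (TopologicalSpace.IsSeparable.of_separableSpace
        (u k '' T n)).exists_countable_dense_subset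
      choose s hsT hs using hCs
      have := hC.to_subtype
      refine ⟨Set.range fun c : C => s c.2, ?_, Set.countable_range _, fun ω hω => ?_⟩
      · rintro _ ⟨c, rfl⟩
        exact hsT c.2
      · obtain ⟨c, hc, hd⟩ := Metric.mem_closure_iff.1 (hCd ⟨ω, hω, rfl⟩) _ (half_pos hε)
        refine ⟨s hc, ⟨⟨c, hc⟩, rfl⟩, fun i => ?_⟩
        have := hupper k ω (hTk hω) (s hc) (hTk (hsT hc)) i
        rw [hs hc] at this
        linarith [hK k (le_max_left _ _)]
    choose D hDT hD hDd using hn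
    refine ⟨⋃ n, D n, Set.iUnion_mono hDT, Set.countable_iUnion hD, fun ω hω => ?_⟩
    obtain ⟨n, hn⟩ := Set.mem_iUnion.1 hω
    obtain ⟨ω', hω', h⟩ := hDd n ω hn
    exact ⟨ω', Set.mem_iUnion.2 ⟨n, hω'⟩, h⟩
  obtain ⟨Y, Ψ, e, hΨ, hY, hF, he⟩ := exists_gds_of_features P hTU hfull g
    (fun ω hω ω' hω' => by
      obtain ⟨N, hN⟩ := hcommon ω hω ω' hω'
      obtain ⟨h1, h2⟩ := hN N le_rfl
      exact ⟨_, hupper N ω h1 ω' h2⟩) hmeas hsep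
  refine ⟨Y, fun k => boxDist_le (hu k) hΨ (hPu k) hY
    (T := T k ∩ {ω | ∀ i, e i (Ψ ω) = g i ω}) (hη₀ k) ?_ le_rfl ?_ ?_⟩
  · have h1 : P (T k) ≤ P (T k ∩ {ω | ∀ i, e i (Ψ ω) = g i ω}) := by
      refine measure_mono_ae ?_
      filter_upwards [he] with ω hω hωT using ⟨hωT, hω⟩
    have h2 := hPT k
    rw [prob_compl_eq_one_sub (hTm k), tsub_le_iff_left] at h2
    exact h2.trans (add_le_add_left h1 _)
  · intro f hf
    obtain ⟨i, h⟩ := hfg k f hf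
    refine ⟨e i, hF ▸ Set.mem_range_self i, fun ω hω => ?_⟩
    rw [hω.2 i]
    exact h ω hω.1
  · rw [hF]
    rintro _ ⟨i, rfl⟩
    obtain ⟨f, hf, h⟩ := hgf k i
    refine ⟨f, hf, fun ω hω => ?_⟩
    rw [hω.2 i]
    exact h ω hω.1

/-- Any point can be continued to a sequence respecting total relations from there on. -/
lemma exists_chain_from {A : ℕ → Type*} [∀ j, Nonempty (A j)] {R : ∀ j, A j → A (j + 1) → Prop}
    (hR : ∀ j a, ∃ b, R j a b) (k : ℕ) (a : A k) :
    ∃ u : ∀ j, A j, u k = a ∧ ∀ j ≥ k, R j (u j) (u (j + 1)) := by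
  induction k generalizing A with
  | zero =>
    choose next hnext using hR
    exact ⟨fun j => Nat.rec a next j, rfl, fun j _ => hnext j _⟩
  | succ k ih =>
    obtain ⟨u, hu, huR⟩ := ih (A := fun j => A (j + 1)) (R := fun j => R (j + 1))
      (fun j => hR (j + 1)) a
    refine ⟨fun j => Nat.casesOn j (Classical.arbitrary _) u, hu, fun j hj => ?_⟩
    obtain ⟨j, rfl⟩ := Nat.exists_eq_succ_of_ne_zero (by omega : j ≠ 0)
    exact huR j (by omega)

lemma exists_limit_of_boxDist_lt {X : ℕ → GDS}
    (h : ∀ k, boxDist (X k) (X (k + 1)) < 2 * ENNReal.ofReal ((1 / 2) ^ k)) :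
    ∃ Y : GDS, ∀ k, boxDist (X k) Y ≤ 2 * ENNReal.ofReal (2 * (1 / 2) ^ k) := by
  choose π hπ S hS hSm hfg hgf using fun k => exists_coupling_of_boxDist_lt (by positivity) (h k)
  have (k : ℕ) : IsProbabilityMeasure (π k) := (hπ k).1
  obtain ⟨P, hP, hPπ⟩ := exists_gluing_seq π fun n => (hπ n).2.2.trans (hπ (n + 1)).2.1.symm
  let T : ℕ → Set (∀ k, (X k).carrier) := fun k => {ω | ∀ j ≥ k, (ω j, ω (j + 1)) ∈ S j}
  have hpair : ∀ j, Measurable fun ω : ∀ k, (X k).carrier => (ω j, ω (j + 1)) :=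
    fun j => by fun_prop
  have hTm : ∀ k, MeasurableSet (T k) := fun k => by
    have : T k = ⋂ j ≥ k, (fun ω => (ω j, ω (j + 1))) ⁻¹' S j := by ext; simp [T]
    rw [this]
    exact MeasurableSet.iInter fun j => MeasurableSet.iInter fun _ => hpair j (hS j).measurableSet
  have hT : Monotone T := fun k l hkl ω hω j hj => hω j (hkl.trans hj)
  have hPT : ∀ k, P (T k)ᶜ ≤ 2 * ENNReal.ofReal (2 * (1 / 2) ^ k) := by
    intro k
    have hsub : (T k)ᶜ ⊆ ⋃ n, ((fun ω => (ω (k + n), ω (k + n + 1))) ⁻¹' S (k + n))ᶜ := by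
      intro ω hω
      simp only [T, Set.mem_compl_iff, Set.mem_ofPred_eq, not_forall] at hω
      obtain ⟨j, hj, hω⟩ := hω
      obtain ⟨n, rfl⟩ := Nat.exists_eq_add_of_le hj
      exact Set.mem_iUnion.2 ⟨n, hω⟩
    have hone : ∀ j, P ((fun ω => (ω j, ω (j + 1))) ⁻¹' S j)ᶜ ≤
        2 * ENNReal.ofReal ((1 / 2) ^ j) := fun j => by
      rw [prob_compl_eq_one_sub (hpair j (hS j).measurableSet), tsub_le_iff_left,
        ← Measure.map_apply (hpair j) (hS j).measurableSet, hPπ]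
      exact (hSm j).le
    refine (measure_mono hsub).trans ((measure_iUnion_le _).trans
      ((ENNReal.tsum_le_tsum fun n => hone (k + n)).trans ?_))
    rw [ENNReal.tsum_mul_left]
    refine mul_le_mul_right ?_ _
    simp_rw [pow_add]
    rw [← ENNReal.ofReal_tsum_of_nonneg (fun n => by positivity)
      (summable_geometric_two.mul_left _), tsum_mul_left, tsum_geometric_two, mul_comm]
  let chain : (∀ k, (X k).carrier → ℝ) → ℕ → Prop := fun f k =>
    ∀ j ≥ k, ∀ p ∈ S j, |f j p.1 - f (j + 1) p.2| ≤ (1 / 2) ^ j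
  let I := {f : ∀ k, (X k).carrier → ℝ // (∀ k, f k ∈ (X k).F) ∧ ∃ k, chain f k}
  have hfwd : ∀ k, ∀ f ∈ (X k).F, ∃ i : I, i.1 k = f ∧ chain i.1 k := by
    intro k f hf
    have (j : ℕ) : Nonempty (X j).F := (X j).F_nonempty.to_subtype
    obtain ⟨v, hv, hvR⟩ := exists_chain_from (A := fun j => (X j).F)
      (R := fun j a b => ∀ p ∈ S j, |a.1 p.1 - b.1 p.2| ≤ (1 / 2) ^ j)
      (fun j a => by simpa using hfg j a a.2) k ⟨f, hf⟩
    exact ⟨⟨fun j => (v j).1, fun j => (v j).2, k, hvR⟩, congrArg Subtype.val hv, hvR⟩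
  have : Nonempty I := by
    obtain ⟨f, hf⟩ := (X 0).F_nonempty
    exact ⟨(hfwd 0 f hf).choose⟩
  let g : I → (∀ k, (X k).carrier) → ℝ := fun i ω => limUnder atTop fun k => i.1 k (ω k)
  have hest : ∀ (i : I) k, chain i.1 k → ∀ ω ∈ T k, |i.1 k (ω k) - g i ω| ≤ 2 * (1 / 2) ^ k := by
    intro i k hi ω hω
    let a : ℕ → ℝ := fun j => i.1 j (ω j)
    have hstep : ∀ n, dist (a (n + k)) (a (n + 1 + k)) ≤
        2 * (1 / 2) ^ k / 2 / 2 ^ n := fun n => by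
      have := hi (n + k) (by omega) _ (hω (n + k) (by omega))
      rw [Real.dist_eq, show n + 1 + k = n + k + 1 by ring]
      refine this.trans (le_of_eq ?_)
      rw [pow_add, one_div, inv_pow, inv_pow]
      field_simp
    have hc := cauchySeq_of_le_geometric_two hstep
    have hl : Tendsto a atTop (𝓝 (g i ω)) := by
      obtain ⟨l, hl⟩ := cauchySeq_tendsto_of_complete hc
      exact tendsto_nhds_limUnder ⟨l, (tendsto_add_atTop_iff_nat k).1 hl⟩
    have := dist_le_of_le_geometric_two_of_tendsto₀ hstep
      ((tendsto_add_atTop_iff_nat k).2 hl)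
    rwa [zero_add, Real.dist_eq] at this
  have hbwd : ∀ k m (i : I), chain i.1 (k + m) → ∃ i' : I, chain i'.1 k ∧ g i' = g i := by
    intro k m
    induction m with
    | zero => exact fun i hi => ⟨i, hi, rfl⟩
    | succ m ih =>
      intro i hi
      obtain ⟨f, hf, hfi⟩ := hgf (k + m) _ (i.2.1 (k + m + 1))
      let f' := Function.update i.1 (k + m) f
      have hne : ∀ j > k + m, f' j = i.1 j := fun j hj => Function.update_of_ne (by omega) _ _
      have hself : f' (k + m) = f := Function.update_self _ _ _
      have hch : chain f' (k + m) := by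
        intro j hj p hp
        rcases hj.eq_or_lt with rfl | hj
        · rw [hself, hne _ (by omega)]
          exact hfi p hp
        · rw [hne _ hj, hne _ (by omega)]
          exact hi j hj p hp
      have hf'F : ∀ j, f' j ∈ (X j).F := by
        intro j
        by_cases hj : j = k + m
        · subst hj
          rwa [hself]
        · rw [show f' j = i.1 j from Function.update_of_ne hj _ _]
          exact i.2.1 j
      obtain ⟨i', hi', hg⟩ := ih ⟨f', hf'F, _, hch⟩ hch
      refine ⟨i', hi', hg.trans (funext fun ω => ?_)⟩
      refine congrArg lim (Filter.map_congr ?_)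
      filter_upwards [eventually_gt_atTop (k + m)] with j hj
      exact congrFun (hne j hj) (ω j)
  have hη : Tendsto (fun k : ℕ => 2 * (1 / 2 : ℝ) ^ k) atTop (𝓝 0) := by
    simpa using (tendsto_pow_atTop_nhds_zero_of_lt_one (r := (1 / 2 : ℝ)) (by norm_num)
      (by norm_num)).const_mul 2
  refine exists_boxDist_le_of_features (P := P) (u := fun k ω => ω k) (g := g)
    (fun k => measurable_pi_apply k) ?_ hT hTm (fun k => by positivity) hη hPT ?_ ?_
  · intro k
    rw [← (hπ k).2.1, ← hPπ k, Measure.map_map measurable_fst (hpair k)]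
    rfl
  · intro k f hf
    obtain ⟨i, rfl, hi⟩ := hfwd k f hf
    exact ⟨i, hest i k hi⟩
  · intro k i
    obtain ⟨n, hn⟩ := i.2.2
    obtain ⟨i', hi', hg⟩ := hbwd k n i fun j hj => hn j (by omega)
    exact ⟨i'.1 k, i'.2.1 k, hg ▸ hest i' k hi'⟩

end Completeness

/-- The box distance on geometric data sets is complete: every
`□`-Cauchy sequence of geometric data sets `□`-converges to some geometric data set.
Moreover, the space of geometric data sets with the box distance is not separable. -/
theorem boxDist_complete_not_separable :
    (∀ Xs : ℕ → GDS,
      (∀ ε : ℝ≥0∞, 0 < ε → ∃ N : ℕ, ∀ m ≥ N, ∀ n ≥ N, boxDist (Xs m) (Xs n) < ε) →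
      ∃ X : GDS, Tendsto (fun n => boxDist (Xs n) X) atTop (𝓝 0)) ∧
    ¬ ∃ D : Set GDS, D.Countable ∧
        ∀ X : GDS, ∀ ε : ℝ≥0∞, 0 < ε → ∃ Y ∈ D, boxDist X Y < ε := by
  refine ⟨fun Xs hXs => ?_, not_exists_countable_dense_boxDist⟩
  have hpos : ∀ k : ℕ, 0 < 2 * ENNReal.ofReal ((1 / 2) ^ k) := fun k =>
    ENNReal.mul_pos two_ne_zero (ENNReal.ofReal_pos.2 (by positivity)).ne'
  choose N hN using fun k : ℕ => hXs _ (hpos k)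
  let φ : ℕ → ℕ := fun k => ∑ j ∈ Finset.range (k + 1), N j
  have hφN : ∀ k, N k ≤ φ k := fun k =>
    Finset.single_le_sum (f := N) (fun _ _ => Nat.zero_le _) (Finset.self_mem_range_succ k)
  have hφ : ∀ k, φ k ≤ φ (k + 1) := fun k => by
    simp only [φ, Finset.sum_range_succ _ (k + 1), Nat.le_add_right]
  obtain ⟨Y, hY⟩ := exists_limit_of_boxDist_lt (X := fun k => Xs (φ k))
    fun k => hN k _ (hφN k) _ ((hφN k).trans (hφ k))
  refine ⟨Y, ENNReal.tendsto_atTop_zero.2 fun ε hε => ?_⟩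
  have hlim : Tendsto (fun k : ℕ => 2 * ENNReal.ofReal ((1 / 2) ^ k + 3 * (1 / 2) ^ k)) atTop
      (𝓝 0) := by
    have h := tendsto_pow_atTop_nhds_zero_of_lt_one (r := (1 / 2 : ℝ)) (by norm_num) (by norm_num)
    simpa using ENNReal.Tendsto.const_mul (ENNReal.tendsto_ofReal (h.add (h.const_mul 3)))
      (Or.inr (by norm_num : (2 : ℝ≥0∞) ≠ ⊤))
  obtain ⟨k, hk⟩ := (hlim.eventually_le_const hε).exists
  refine ⟨N k, fun n hn => (boxDist_lt_add (by positivity) (by positivity)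
    (hN k n hn _ (hφN k)) ((hY k).trans_lt ?_)).trans hk⟩
  have : (0 : ℝ) < (1 / 2) ^ k := by positivity
  refine ENNReal.mul_lt_mul_right two_ne_zero (by norm_num) ?_
  exact (ENNReal.ofReal_lt_ofReal_iff (by positivity)).2 (by linarith)
end
end
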